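/- arXiv:2011.04025 — 2 statements merged into one kernel-verified Lean document; each statement's English description precedes it below -/
import Mathlib

section
/- Fix a natural number k ≥ 1 and consider K = {(x₁, x₂) ∈ ℝ² : x₁ ≥ 0 and x₂ - x₁^k ≥ 0}. If a real polynomial p ∈ ℝ[x₁, x₂] is bounded on K (i.e., there is C with |p(x)| ≤ C for all x ∈ K), then p is a constant polynomial. -/
open MvPolynomial

/-- A real polynomial whose absolute value is bounded on a half-line takes only one value. -/
theorem Polynomial.eval_eq_eval_of_abs_le_on_Ici {q : Polynomial ℝ} {b B : ℝ}
    (h : ∀ t, b ≤ t → |q.eval t| ≤ B) (s t : ℝ) : q.eval s = q.eval t := by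
  have hq : q.degree ≤ 0 := by
    rw [← Polynomial.isBoundedUnder_abs_atTop_iff]
    refine ⟨B, Filter.eventually_map.2 ?_⟩
    filter_upwards [Filter.eventually_ge_atTop b] with x hx using h x hx
  rw [Polynomial.eq_C_of_degree_le_zero hq]
  simp

/-- Restricting a bivariate polynomial to a polynomial curve amounts to substitution. -/
theorem MvPolynomial.eval_aeval_curve (p : MvPolynomial (Fin 2) ℝ) (f g : Polynomial ℝ) (t : ℝ) :
    (aeval ![f, g] p).eval t = eval ![f.eval t, g.eval t] p := by
  induction p using MvPolynomial.induction_on with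
  | C a => simp
  | add p q hp hq => simp [hp, hq]
  | mul_X p i hp => fin_cases i <;> simp [hp]

/-- On the unbounded semi-algebraic set `K = {x ∈ ℝ² : x₁ ≥ 0, x₂ - x₁^k ≥ 0}` (with
`k ≥ 1`), the only bounded polynomials are the constants. -/
theorem bounded_polynomial_on_region_is_constant
    (k : ℕ) (hk : 1 ≤ k)
    (p : MvPolynomial (Fin 2) ℝ)
    (hbd : ∃ C : ℝ, ∀ x : Fin 2 → ℝ,
      0 ≤ x 0 → 0 ≤ x 1 - x 0 ^ k → |eval x p| ≤ C) :
    ∃ c : ℝ, p = C c := by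
  obtain ⟨B, hB⟩ := hbd
  have vertical : ∀ a : ℝ, 0 ≤ a → ∀ s t : ℝ, eval ![a, s] p = eval ![a, t] p := by
    intro a ha s t
    have h := Polynomial.eval_eq_eval_of_abs_le_on_Ici
      (q := aeval ![Polynomial.C a, Polynomial.X] p) (b := a ^ k) (B := B) (fun t ht => by
        rw [eval_aeval_curve]
        exact hB _ (by simpa using ha) (by simpa using ht)) s t
    simpa [eval_aeval_curve] using h
  have boundary : ∀ s t : ℝ, eval ![s, s ^ k] p = eval ![t, t ^ k] p := by
    intro s t
    have h := Polynomial.eval_eq_eval_of_abs_le_on_Ici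
      (q := aeval ![Polynomial.X, Polynomial.X ^ k] p) (b := 0) (B := B) (fun t ht => by
        rw [eval_aeval_curve]
        exact hB _ (by simpa using ht) (by simp)) s t
    simpa [eval_aeval_curve] using h
  refine ⟨eval ![0, 0 ^ k] p, ?_⟩
  refine funext_set (fun _ => Set.Ici (0 : ℝ)) (fun _ => Set.Ici_infinite 0) fun x hx => ?_
  have hx0 : 0 ≤ x 0 := hx 0 (Set.mem_univ 0)
  have hxe : x = ![x 0, x 1] := by
    ext i
    fin_cases i <;> rfl
  rw [eval_C, hxe, vertical _ hx0 (x 1) (x 0 ^ k), boundary (x 0) 0]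
end

section
/- Fix a natural number k ≥ 1 and set f₁ = x₂ - x₁^k, f₂ = x₁ in ℝ[x₁, x₂]. Let L be a linear functional on ℝ[x₁, x₂] satisfying L(p²) ≥ 0, L((x₂ - x₁^k)·p²) ≥ 0 and L(x₁·p²) ≥ 0 for all p ∈ ℝ[x₁, x₂], and such that Σ_{n=1}^∞ L((x₂ - x₁^k)ⁿ)^{-1/(2n)} = +∞ and Σ_{n=1}^∞ L(x₁ⁿ)^{-1/(2n)} = +∞. Then L is a moment functional with a unique representing measure, and this measure is supported on the set K = {(x₁, x₂) ∈ ℝ² : x₁ ≥ 0 and x₂ - x₁^k ≥ 0}. -/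
open MeasureTheory MvPolynomial

/-- A weighted partial-sum estimate behind Carleman's inequality. -/
lemma sum_weighted_average_le {x : ℕ → ℝ} (hx : ∀ k, 0 ≤ x k) (m : ℕ) :
    ∑ n ∈ Finset.range m, (∑ k ∈ Finset.range (n + 1), ((k : ℝ) + 1) * x k) / ((n : ℝ) + 1) ^ 2
      ≤ 2 * ∑ k ∈ Finset.range m, x k := by
  have hT : ∀ m : ℕ, 0 ≤ ∑ k ∈ Finset.range m, ((k : ℝ) + 1) * x k := fun m =>
    Finset.sum_nonneg fun k _ => mul_nonneg (by positivity) (hx k)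
  suffices h : ∑ n ∈ Finset.range m,
      (∑ k ∈ Finset.range (n + 1), ((k : ℝ) + 1) * x k) / ((n : ℝ) + 1) ^ 2
      + (∑ k ∈ Finset.range m, ((k : ℝ) + 1) * x k) / m ≤ 2 * ∑ k ∈ Finset.range m, x k by
    have : 0 ≤ (∑ k ∈ Finset.range m, ((k : ℝ) + 1) * x k) / m := div_nonneg (hT m) (by positivity)
    linarith
  induction m with
  | zero => simp
  | succ m ih =>
    rw [Finset.sum_range_succ, Finset.sum_range_succ (fun k => x k), mul_add]
    have key : (∑ k ∈ Finset.range (m + 1), ((k : ℝ) + 1) * x k) / ((m : ℝ) + 1) ^ 2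
        + (∑ k ∈ Finset.range (m + 1), ((k : ℝ) + 1) * x k) / ((m + 1 : ℕ) : ℝ)
        ≤ (∑ k ∈ Finset.range m, ((k : ℝ) + 1) * x k) / m + 2 * x m := by
      rw [Finset.sum_range_succ]
      have h0 := hT m
      have hxm := hx m
      rcases Nat.eq_zero_or_pos m with rfl | hm
      · simp; linarith
      · set T := ∑ k ∈ Finset.range m, ((k : ℝ) + 1) * x k
        have hm' : (0 : ℝ) < m := by exact_mod_cast hm
        push_cast
        have e1 : (T + ((m : ℝ) + 1) * x m) / ((m : ℝ) + 1) ^ 2 + (T + ((m : ℝ) + 1) * x m) / ((m : ℝ) + 1)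
            = T / m - T / (m * ((m : ℝ) + 1) ^ 2) + (x m / ((m : ℝ) + 1) + x m) := by
          field_simp; ring
        rw [e1]
        have h1 : 0 ≤ T / (m * ((m : ℝ) + 1) ^ 2) := by positivity
        have h2 : x m / ((m : ℝ) + 1) ≤ x m := div_le_self hxm (by linarith)
        linarith
    linarith

/-- **Carleman's inequality**, qualitative form. -/
lemma summable_geom_mean {x : ℕ → ℝ} (hx : ∀ k, 0 ≤ x k) (hs : Summable x) :
    Summable fun n : ℕ => (∏ k ∈ Finset.range (n + 1), x k) ^ (1 / ((n : ℝ) + 1)) := by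
  have hterm : ∀ n : ℕ, (∏ k ∈ Finset.range (n + 1), x k) ^ (1 / ((n : ℝ) + 1)) ≤
      Real.exp 1 * ((∑ k ∈ Finset.range (n + 1), ((k : ℝ) + 1) * x k) / ((n : ℝ) + 1) ^ 2) := by
    intro n
    have hn : (0 : ℝ) < (n : ℝ) + 1 := by positivity
    have hamgm := Real.geom_mean_le_arith_mean (Finset.range (n + 1)) (fun _ => (1 : ℝ))
      (fun k => ((k : ℝ) + 1) * x k) (fun _ _ => zero_le_one) (by simp; positivity)
      (fun k _ => mul_nonneg (by positivity) (hx k))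
    simp only [Real.rpow_one, one_mul, Finset.sum_const, Finset.card_range, nsmul_eq_mul, mul_one,
      Finset.prod_mul_distrib] at hamgm
    push_cast at hamgm
    have hfac : ∏ k ∈ Finset.range (n + 1), ((k : ℝ) + 1) = ((n + 1).factorial : ℝ) := by
      rw [← Finset.prod_range_add_one_eq_factorial]; push_cast; rfl
    have hP : 0 ≤ ∏ k ∈ Finset.range (n + 1), x k := Finset.prod_nonneg fun k _ => hx k
    rw [hfac, Real.mul_rpow (by positivity) hP] at hamgm
    have hexp : ((n : ℝ) + 1) / Real.exp 1 ≤ ((n + 1).factorial : ℝ) ^ ((n : ℝ) + 1)⁻¹ := by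
      have h1 := Real.pow_div_factorial_le_exp (x := (n : ℝ) + 1) hn.le (n + 1)
      have h2 : (((n : ℝ) + 1) / Real.exp 1) ^ (n + 1) ≤ ((n + 1).factorial : ℝ) := by
        rw [div_pow, ← Real.exp_nat_mul]
        rw [div_le_iff₀ (by positivity)] at h1 ⊢
        rw [mul_comm] at h1
        simpa using h1
      calc ((n : ℝ) + 1) / Real.exp 1
          = ((((n : ℝ) + 1) / Real.exp 1) ^ (n + 1)) ^ (((n + 1 : ℕ) : ℝ))⁻¹ := by
            rw [Real.pow_rpow_inv_natCast (by positivity) (by omega)]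
        _ ≤ _ := by
          push_cast
          exact Real.rpow_le_rpow (by positivity) h2 (by positivity)
    rw [one_div]
    set G := (∏ k ∈ Finset.range (n + 1), x k) ^ ((n : ℝ) + 1)⁻¹
    have hG : 0 ≤ G := Real.rpow_nonneg hP _
    have h3 := (mul_le_mul_of_nonneg_right hexp hG).trans hamgm
    set T := ∑ k ∈ Finset.range (n + 1), ((k : ℝ) + 1) * x k
    have e : G = Real.exp 1 / ((n : ℝ) + 1) * (((n : ℝ) + 1) / Real.exp 1 * G) := by
      field_simp
    rw [e]
    calc _ ≤ Real.exp 1 / ((n : ℝ) + 1) * (T / ((n : ℝ) + 1)) := by gcongr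
      _ = _ := by field_simp
  refine summable_of_sum_range_le (c := Real.exp 1 * (2 * ∑' k, x k))
    (fun n => Real.rpow_nonneg (Finset.prod_nonneg fun k _ => hx k) _) fun m => ?_
  calc _ ≤ ∑ n ∈ Finset.range m, Real.exp 1 *
        ((∑ k ∈ Finset.range (n + 1), ((k : ℝ) + 1) * x k) / ((n : ℝ) + 1) ^ 2) :=
        Finset.sum_le_sum fun n _ => hterm n
    _ ≤ _ := by
      rw [← Finset.mul_sum]
      gcongr
      refine (sum_weighted_average_le hx m).trans ?_
      gcongr
      exact hs.sum_le_tsum _ fun k _ => hx k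

/-- An operator `T`, symmetric for the positive semidefinite form `B`, that is odd for the
`B`-isometry `S`. -/
structure IsOddSymmetric {V : Type*} [AddCommGroup V] [Module ℝ V] (B : V →ₗ[ℝ] V →ₗ[ℝ] ℝ)
    (T S : V →ₗ[ℝ] V) : Prop where
  symm : ∀ v w, B v w = B w v
  nonneg : ∀ v, 0 ≤ B v v
  selfAdjoint : ∀ v w, B (T v) w = B v (T w)
  isometry : ∀ v w, B (S v) (S w) = B v w
  odd : ∀ v, S (T v) = -T (S v)

section Jacobi

variable {V : Type*} [AddCommGroup V] [Module ℝ V]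

/-- The monic orthogonal sequence of an odd symmetric operator, started at `v`. -/
noncomputable def jacobiSeq (B : V →ₗ[ℝ] V →ₗ[ℝ] ℝ) (T : V →ₗ[ℝ] V) (v : V) : ℕ → V
  | 0 => v
  | 1 => T v
  | n + 2 => T (jacobiSeq B T v (n + 1)) -
      (B (jacobiSeq B T v (n + 1)) (jacobiSeq B T v (n + 1)) /
        B (jacobiSeq B T v n) (jacobiSeq B T v n)) • jacobiSeq B T v n

variable {B : V →ₗ[ℝ] V →ₗ[ℝ] ℝ} {T S : V →ₗ[ℝ] V} {v : V}

lemma jacobiSeq_parity (h : IsOddSymmetric B T S) (hv : S v = v) (n : ℕ) :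
    S (jacobiSeq B T v n) = (-1 : ℝ) ^ n • jacobiSeq B T v n := by
  induction n using Nat.twoStepInduction with
  | zero => simp [jacobiSeq, hv]
  | one => simp [jacobiSeq, h.odd, hv]
  | more n ih1 ih2 =>
    rw [jacobiSeq, map_sub, map_smul, h.odd, ih1, ih2, map_smul, smul_sub, smul_comm _ ((-1 : ℝ) ^ n),
      ← neg_smul]
    simp [pow_succ]

lemma jacobiSeq_apply_self (h : IsOddSymmetric B T S) (hv : S v = v) (n : ℕ) :
    B (jacobiSeq B T v n) (T (jacobiSeq B T v n)) = 0 := by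
  have h1 := h.isometry (jacobiSeq B T v n) (T (jacobiSeq B T v n))
  rw [h.odd, jacobiSeq_parity h hv] at h1
  simp only [map_smul, map_neg, LinearMap.smul_apply, smul_eq_mul] at h1
  have : ((-1 : ℝ) ^ n) * (-1) ^ n = 1 := by rw [← mul_pow]; simp
  linear_combination (-1 / 2 : ℝ) * h1 - (1 / 2) * B (jacobiSeq B T v n) (T (jacobiSeq B T v n)) * this

lemma apply_jacobiSeq (n : ℕ) :
    T (jacobiSeq B T v (n + 1)) = jacobiSeq B T v (n + 2) +
      (B (jacobiSeq B T v (n + 1)) (jacobiSeq B T v (n + 1)) /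
        B (jacobiSeq B T v n) (jacobiSeq B T v n)) • jacobiSeq B T v n := by
  rw [jacobiSeq]; abel

lemma jacobiSeq_orthogonal (h : IsOddSymmetric B T S) (hv : S v = v)
    (hpos : ∀ n, 0 < B (jacobiSeq B T v n) (jacobiSeq B T v n)) (n : ℕ) :
    ∀ m < n, B (jacobiSeq B T v n) (jacobiSeq B T v m) = 0 := by
  induction n using Nat.strong_induction_on with
  | _ n ih =>
    match n with
    | 0 => intro m hm; omega
    | 1 =>
      intro m hm
      obtain rfl : m = 0 := by omega
      rw [h.symm]
      exact jacobiSeq_apply_self h hv 0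
    | n + 2 =>
      intro m hm
      rw [jacobiSeq, map_sub, LinearMap.sub_apply, map_smul, LinearMap.smul_apply, smul_eq_mul]
      rcases (by omega : m = n + 1 ∨ m = n ∨ m < n) with rfl | rfl | hlt
      · rw [h.symm, jacobiSeq_apply_self h hv, h.symm (jacobiSeq B T v n) (jacobiSeq B T v (n + 1)),
          ih (n + 1) (by omega) n (by omega)]
        ring
      · rw [h.selfAdjoint, div_mul_cancel₀ _ (hpos m).ne']
        match m with
        | 0 => simp [jacobiSeq]
        | m + 1 =>
          rw [apply_jacobiSeq, map_add, map_smul, ih (m + 2) (by omega) m (by omega)]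
          simp
      · rw [ih n (by omega) m hlt, h.selfAdjoint]
        match m with
        | 0 =>
          have := ih (n + 1) (by omega) 1 (by omega)
          simp only [jacobiSeq] at this ⊢
          simp [this]
        | m + 1 =>
          rw [apply_jacobiSeq, map_add, map_smul, ih (n + 1) (by omega) m (by omega),
            ih (n + 1) (by omega) (m + 2) (by omega)]
          simp

lemma apply_iterate_jacobiSeq (h : IsOddSymmetric B T S) (hv : S v = v)
    (hpos : ∀ n, 0 < B (jacobiSeq B T v n) (jacobiSeq B T v n)) (k : ℕ) :
    B ((T ^ k) v) (jacobiSeq B T v k) = B (jacobiSeq B T v k) (jacobiSeq B T v k) ∧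
      ∀ m, k < m → B ((T ^ k) v) (jacobiSeq B T v m) = 0 := by
  induction k with
  | zero =>
    refine ⟨rfl, fun m hm => ?_⟩
    rw [h.symm]
    exact jacobiSeq_orthogonal h hv hpos m 0 hm
  | succ k ih =>
    have hstep : ∀ m, k < m + 1 → B ((T ^ (k + 1)) v) (jacobiSeq B T v (m + 1)) =
        (B (jacobiSeq B T v (m + 1)) (jacobiSeq B T v (m + 1)) /
          B (jacobiSeq B T v m) (jacobiSeq B T v m)) * B ((T ^ k) v) (jacobiSeq B T v m) := by
      intro m hm
      rw [pow_succ', Module.End.mul_apply, h.selfAdjoint, apply_jacobiSeq, map_add, map_smul,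
        ih.2 (m + 2) (by omega), zero_add, smul_eq_mul]
    refine ⟨?_, fun m hm => ?_⟩
    · rw [hstep k (by omega), ih.1, div_mul_cancel₀ _ (hpos k).ne']
    · obtain ⟨m, rfl⟩ : ∃ m', m = m' + 1 := ⟨m - 1, by omega⟩
      rw [hstep m (by omega), ih.2 m (by omega), mul_zero]

/-- The Cauchy–Schwarz inequality for a positive semidefinite symmetric form. -/
lemma sq_apply_le (hs : ∀ v w, B v w = B w v) (hn : ∀ v, 0 ≤ B v v) (v w : V) :
    B v w ^ 2 ≤ B v v * B w w := by
  have := discrim_le_zero (a := B w w) (b := 2 * B v w) (c := B v v) fun x => by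
    have := hn (v + x • w)
    simp only [map_add, LinearMap.add_apply, map_smul, LinearMap.smul_apply, smul_eq_mul,
      hs w v] at this
    linarith
  rw [discrim] at this
  linarith

lemma jacobiSeq_norm_le (h : IsOddSymmetric B T S) (hv : S v = v)
    (hpos : ∀ n, 0 < B (jacobiSeq B T v n) (jacobiSeq B T v n)) (n : ℕ) :
    B (jacobiSeq B T v n) (jacobiSeq B T v n) ≤ B ((T ^ n) v) ((T ^ n) v) := by
  have h1 := sq_apply_le h.symm h.nonneg ((T ^ n) v) (jacobiSeq B T v n)
  rw [(apply_iterate_jacobiSeq h hv hpos n).1, sq] at h1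
  exact le_of_mul_le_mul_right h1 (hpos n)

variable {e : V →ₗ[ℝ] ℝ} {γ : ℝ}

/-- The Christoffel–Darboux identity at an imaginary point. -/
lemma jacobiSeq_christoffel_darboux (h : IsOddSymmetric B T S) (hv : S v = v)
    (he : ∀ w, e (T w) = γ * e (S w)) (n : ℕ)
    (hpos : ∀ k ≤ n, 0 < B (jacobiSeq B T v k) (jacobiSeq B T v k)) :
    (-1) ^ n * e (jacobiSeq B T v n) * e (jacobiSeq B T v (n + 1)) /
        B (jacobiSeq B T v n) (jacobiSeq B T v n) =
      γ * ∑ k ∈ Finset.range (n + 1),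
        e (jacobiSeq B T v k) ^ 2 / B (jacobiSeq B T v k) (jacobiSeq B T v k) := by
  induction n with
  | zero => simp [jacobiSeq, he, hv]; ring
  | succ n ih =>
    rw [Finset.sum_range_succ, mul_add, ← ih fun k hk => hpos k (by omega)]
    have h0 := (hpos n (by omega)).ne'
    have h1 := (hpos (n + 1) le_rfl).ne'
    rw [show jacobiSeq B T v (n + 1 + 1) = jacobiSeq B T v (n + 2) from rfl, jacobiSeq, map_sub, he,
      jacobiSeq_parity h hv, map_smul, map_smul]
    simp only [smul_eq_mul]
    have : ((-1 : ℝ) ^ n) * (-1) ^ n = 1 := by rw [← mul_pow]; simp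
    field_simp
    rw [pow_succ]
    linear_combination B (jacobiSeq B T v n) (jacobiSeq B T v n) * e (jacobiSeq B T v (n + 1)) ^ 2
      * γ * this

lemma christoffel_sum_ge (h : IsOddSymmetric B T S) (he0 : e v = 1) (n : ℕ) :
    (B v v)⁻¹ ≤ ∑ k ∈ Finset.range (n + 1),
      e (jacobiSeq B T v k) ^ 2 / B (jacobiSeq B T v k) (jacobiSeq B T v k) := by
  refine le_trans ?_ (Finset.single_le_sum
    (f := fun k => e (jacobiSeq B T v k) ^ 2 / B (jacobiSeq B T v k) (jacobiSeq B T v k))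
    (fun k _ => div_nonneg (sq_nonneg _) (h.nonneg _)) (Finset.mem_range.2 (Nat.succ_pos n)))
  simp [jacobiSeq, he0]

lemma summable_of_christoffel_bounded (h : IsOddSymmetric B T S) (hv : S v = v) (hγ : 0 < γ)
    (he : ∀ w, e (T w) = γ * e (S w)) (he0 : e v = 1)
    (hpos : ∀ n, 0 < B (jacobiSeq B T v n) (jacobiSeq B T v n))
    (hs : Summable fun k =>
      e (jacobiSeq B T v k) ^ 2 / B (jacobiSeq B T v k) (jacobiSeq B T v k)) :
    Summable fun n : ℕ => (B ((T ^ (n + 1)) v) ((T ^ (n + 1)) v)) ^ (-(1 / (2 * ((n : ℝ) + 1)))) := by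
  set p : ℕ → ℝ := fun n => B (jacobiSeq B T v n) (jacobiSeq B T v n) with hp
  set E : ℕ → ℝ := fun n => e (jacobiSeq B T v n) with hE
  have hx : Summable fun k => √(p k / p (k + 1)) := by
    refine Summable.of_nonneg_of_le (fun k => Real.sqrt_nonneg _) (fun k => ?_)
      ((hs.add ((summable_nat_add_iff 1).2 hs)).mul_left (p 0 / γ))
    have hcd := jacobiSeq_christoffel_darboux h hv he k fun j _ => hpos j
    have hge := mul_le_mul_of_nonneg_left (christoffel_sum_ge h he0 k) hγ.le
    rw [← hcd] at hge
    change γ * (p 0)⁻¹ ≤ (-1) ^ k * E k * E (k + 1) / p k at hge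
    change √(p k / p (k + 1)) ≤ p 0 / γ * (E k ^ 2 / p k + E (k + 1) ^ 2 / p (k + 1))
    have h0 : 0 < p 0 := hpos 0
    have hk : 0 < p k := hpos k
    have hk1 : 0 < p (k + 1) := hpos (k + 1)
    set r := √(p k / p (k + 1)) with hr
    have hr0 : 0 ≤ r := Real.sqrt_nonneg _
    have hr2 : r ^ 2 = p k / p (k + 1) := Real.sq_sqrt (by positivity)
    have habs : γ * (p 0)⁻¹ ≤ |E k| * |E (k + 1)| / p k := by
      refine hge.trans (div_le_div_of_nonneg_right ((le_abs_self _).trans ?_) hk.le)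
      rw [abs_mul, abs_mul, abs_pow, abs_neg, abs_one, one_pow, one_mul]
    have h1 : |E k| * |E (k + 1)| / p k * r ≤ E k ^ 2 / p k + E (k + 1) ^ 2 / p (k + 1) := by
      have h2 : E (k + 1) ^ 2 / p (k + 1) = (|E (k + 1)| * r) ^ 2 / p k := by
        rw [mul_pow, hr2, sq_abs]; field_simp
      rw [h2, ← sq_abs (E k), ← add_div, div_mul_eq_mul_div]
      gcongr
      nlinarith [sq_nonneg (|E k| - |E (k + 1)| * r), mul_nonneg (abs_nonneg (E k))
        (mul_nonneg (abs_nonneg (E (k + 1))) hr0)]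
    have h3 := (mul_le_mul_of_nonneg_right habs hr0).trans h1
    calc r = p 0 / γ * (γ * (p 0)⁻¹ * r) := by field_simp
      _ ≤ _ := by gcongr
  have hprod : ∀ n, ∏ k ∈ Finset.range n, √(p k / p (k + 1)) = √(p 0 / p n) := by
    intro n
    induction n with
    | zero => simp [div_self (show p 0 ≠ 0 from (hpos 0).ne')]
    | succ n ih =>
      rw [Finset.prod_range_succ, ih, ← Real.sqrt_mul (div_nonneg (hpos 0).le (hpos n).le),
        div_mul_div_cancel₀ (show p n ≠ 0 from (hpos n).ne')]
  refine Summable.of_nonneg_of_le (fun n => Real.rpow_nonneg (h.nonneg _) _) (fun n => ?_)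
    ((summable_geom_mean (fun k => Real.sqrt_nonneg _) hx).mul_left (1 + (p 0)⁻¹))
  rw [hprod]
  have h0 : 0 < p 0 := hpos 0
  have hn : 0 < p (n + 1) := hpos (n + 1)
  have hle : p (n + 1) ≤ B ((T ^ (n + 1)) v) ((T ^ (n + 1)) v) := jacobiSeq_norm_le h hv hpos (n + 1)
  set t : ℝ := 1 / (2 * ((n : ℝ) + 1)) with ht
  have ht0 : 0 ≤ t := by positivity
  have ht1 : t ≤ 1 := by
    rw [ht, div_le_one (by positivity)]
    have : (0 : ℝ) ≤ n := by positivity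
    linarith
  have h2 : √(p 0 / p (n + 1)) ^ (1 / ((n : ℝ) + 1)) = (p 0 / p (n + 1)) ^ t := by
    rw [Real.sqrt_eq_rpow, ← Real.rpow_mul (by positivity)]
    congr 1
    rw [ht]; field_simp
  rw [h2]
  calc _ ≤ p (n + 1) ^ (-t) := Real.rpow_le_rpow_of_nonpos hn hle (by linarith)
    _ = ((p 0)⁻¹) ^ t * (p 0 / p (n + 1)) ^ t := by
      rw [← Real.mul_rpow (by positivity) (by positivity), Real.rpow_neg hn.le, ← Real.inv_rpow hn.le]
      congr 1
      field_simp
    _ ≤ (1 + (p 0)⁻¹) * (p 0 / p (n + 1)) ^ t := by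
      gcongr
      have hp0 : 0 < (p 0)⁻¹ := by positivity
      calc ((p 0)⁻¹) ^ t ≤ (1 + (p 0)⁻¹) ^ t := Real.rpow_le_rpow hp0.le (by linarith) ht0
        _ ≤ (1 + (p 0)⁻¹) ^ (1 : ℝ) := Real.rpow_le_rpow_of_exponent_le (by linarith) ht1
        _ = _ := Real.rpow_one _

/-- Under Carleman's condition the Christoffel function at an imaginary point vanishes. -/
lemma exists_small_of_carleman (h : IsOddSymmetric B T S) (hv : S v = v) (hγ : 0 < γ)
    (he : ∀ w, e (T w) = γ * e (S w)) (he0 : e v = 1)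
    (hc : (∃ n : ℕ, B ((T ^ n) v) ((T ^ n) v) = 0) ∨ ¬ Summable fun n : ℕ =>
      (B ((T ^ (n + 1)) v) ((T ^ (n + 1)) v)) ^ (-(1 / (2 * ((n : ℝ) + 1)))))
    {ε : ℝ} (hε : 0 < ε) : ∃ w, e w = 1 ∧ B w w < ε := by
  by_cases hall : ∀ n, 0 < B (jacobiSeq B T v n) (jacobiSeq B T v n)
  · have hns : ¬ Summable fun k =>
        e (jacobiSeq B T v k) ^ 2 / B (jacobiSeq B T v k) (jacobiSeq B T v k) := by
      intro hs
      rcases hc with ⟨n, hn⟩ | hc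
      · exact absurd (jacobiSeq_norm_le h hv hall n) (by rw [hn]; exact not_le.2 (hall n))
      · exact hc (summable_of_christoffel_bounded h hv hγ he he0 hall hs)
    obtain ⟨N, hN⟩ : ∃ N, ε⁻¹ < ∑ k ∈ Finset.range N,
        e (jacobiSeq B T v k) ^ 2 / B (jacobiSeq B T v k) (jacobiSeq B T v k) := by
      by_contra! hb
      exact hns (summable_of_sum_range_le (fun k => div_nonneg (sq_nonneg _) (h.nonneg _)) hb)
    set s := ∑ k ∈ Finset.range N,
        e (jacobiSeq B T v k) ^ 2 / B (jacobiSeq B T v k) (jacobiSeq B T v k) with hs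
    have hs0 : 0 < s := lt_trans (by positivity) hN
    set P := ∑ k ∈ Finset.range N,
      (e (jacobiSeq B T v k) / B (jacobiSeq B T v k) (jacobiSeq B T v k)) • jacobiSeq B T v k with hP
    have heP : e P = s := by
      rw [hP, map_sum, hs]
      refine Finset.sum_congr rfl fun k _ => ?_
      rw [map_smul, smul_eq_mul]; ring
    have hBP : B P P = s := by
      rw [hs, hP]
      simp only [map_sum, LinearMap.sum_apply]
      refine Finset.sum_congr rfl fun k hk => ?_
      rw [Finset.sum_eq_single_of_mem k hk]
      · simp only [map_smul, LinearMap.smul_apply, smul_eq_mul]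
        have := (hall k).ne'
        field_simp
      · intro j _ hj
        simp only [map_smul, LinearMap.smul_apply, smul_eq_mul]
        have : B (jacobiSeq B T v j) (jacobiSeq B T v k) = 0 := by
          rcases lt_or_gt_of_ne hj with hlt | hlt
          · rw [h.symm]; exact jacobiSeq_orthogonal h hv hall k j hlt
          · exact jacobiSeq_orthogonal h hv hall j k hlt
        rw [this]; ring
    refine ⟨s⁻¹ • P, by rw [map_smul, heP, smul_eq_mul, inv_mul_cancel₀ hs0.ne'], ?_⟩
    simp only [map_smul, LinearMap.smul_apply, smul_eq_mul, hBP]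
    rw [inv_mul_cancel₀ hs0.ne', mul_one]
    exact inv_lt_of_inv_lt₀ hε hN
  · push Not at hall
    classical
    have hle := Nat.find_spec hall
    have hmin : ∀ k < Nat.find hall, 0 < B (jacobiSeq B T v k) (jacobiSeq B T v k) := fun k hk =>
      not_le.1 (Nat.find_min hall hk)
    set n := Nat.find hall
    have hne : e (jacobiSeq B T v n) ≠ 0 := by
      rcases Nat.eq_zero_or_pos n with h0 | h0
      · rw [h0]; simp [jacobiSeq, he0]
      · obtain ⟨m, hm⟩ : ∃ m, n = m + 1 := ⟨n - 1, by omega⟩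
        intro hz
        have hcd := jacobiSeq_christoffel_darboux h hv he m fun k hk => hmin k (by omega)
        rw [← hm, hz, mul_zero, zero_div] at hcd
        have hB : 0 < B v v := hmin 0 h0
        have := mul_le_mul_of_nonneg_left (christoffel_sum_ge h he0 m) hγ.le
        rw [← hm, ← hcd] at this
        exact absurd this (not_le.2 (by positivity))
    refine ⟨(e (jacobiSeq B T v n))⁻¹ • jacobiSeq B T v n, ?_, ?_⟩
    · rw [map_smul, smul_eq_mul, inv_mul_cancel₀ hne]
    · have : B (jacobiSeq B T v n) (jacobiSeq B T v n) = 0 := le_antisymm hle (h.nonneg _)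
      simp [this, hε]

end Jacobi

section LogConvex

variable {a : ℕ → ℝ}

lemma pow_succ_le_of_logConvex (ha : ∀ n, 0 < a n) (hlc : ∀ n, a (n + 1) ^ 2 ≤ a n * a (n + 2))
    (n : ℕ) : a n ^ (n + 1) ≤ a 0 * a (n + 1) ^ n := by
  induction n with
  | zero => simp
  | succ n ih =>
    have h0 := ha 0
    have h1 := ha n
    have h2 := ha (n + 1)
    have h3 := ha (n + 2)
    have h4 : (a (n + 1) ^ 2) ^ (n + 1) ≤ (a n * a (n + 2)) ^ (n + 1) :=
      pow_le_pow_left₀ (by positivity) (hlc n) _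
    rw [mul_pow] at h4
    have h5 := h4.trans (mul_le_mul_of_nonneg_right ih (by positivity))
    refine le_of_mul_le_mul_left ?_ (pow_pos h2 n)
    calc _ = (a (n + 1) ^ 2) ^ (n + 1) := by ring
      _ ≤ _ := h5
      _ = _ := by ring

lemma rpow_le_one_add_of_nonneg {x t : ℝ} (hx : 0 ≤ x) (ht0 : 0 ≤ t) (ht1 : t ≤ 1) :
    x ^ t ≤ 1 + x :=
  calc x ^ t ≤ (1 + x) ^ t := Real.rpow_le_rpow hx (by linarith) ht0
    _ ≤ (1 + x) ^ (1 : ℝ) := Real.rpow_le_rpow_of_exponent_le (by linarith) ht1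
    _ = _ := Real.rpow_one _

lemma summable_of_summable_even (ha : ∀ n, 0 < a n)
    (hlc : ∀ n, a (n + 1) ^ 2 ≤ a n * a (n + 2))
    (hs : Summable fun n : ℕ => (a (2 * (n + 1))) ^ (-(1 / (4 * ((n : ℝ) + 1))))) :
    Summable fun n : ℕ => (a (n + 1)) ^ (-(1 / (2 * ((n : ℝ) + 1)))) := by
  rw [← summable_nat_add_iff 1]
  refine Summable.even_add_odd (hs.congr fun n => ?_)
    (Summable.of_nonneg_of_le (fun n => Real.rpow_nonneg (ha _).le _) (fun n => ?_)
      (hs.mul_left (1 + a 0)))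
  · push_cast
    rw [show 2 * (n + 1) = 2 * n + 1 + 1 by ring]
    congr 3
    ring
  · have h0 := ha 0
    have h1 := ha (2 * (n + 1))
    have h2 := ha (2 * (n + 1) + 1)
    have key := pow_succ_le_of_logConvex ha hlc (2 * (n + 1))
    set j : ℕ := 2 * (n + 1) with hj
    have hj0 : (0 : ℝ) < j := by rw [hj]; positivity
    have hjr : (j : ℝ) = 2 * ((n : ℝ) + 1) := by rw [hj]; push_cast; ring
    set t : ℝ := 1 / (2 * j * (j + 1)) with ht
    have ht0 : 0 ≤ t := by positivity
    have ht1 : t ≤ 1 := by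
      rw [ht, div_le_one (by positivity), hjr]
      nlinarith [(Nat.cast_nonneg n : (0 : ℝ) ≤ n)]
    have h3 := Real.rpow_le_rpow (by positivity) key ht0
    rw [Real.mul_rpow h0.le (by positivity), ← Real.rpow_natCast_mul h1.le,
      ← Real.rpow_natCast_mul h2.le] at h3
    have e1 : ((j + 1 : ℕ) : ℝ) * t = 1 / (4 * ((n : ℝ) + 1)) := by
      rw [ht]; push_cast; field_simp; rw [hjr]; ring
    have e2 : (j : ℝ) * t = 1 / (2 * ((j : ℝ) + 1)) := by rw [ht]; field_simp
    rw [e1, e2] at h3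
    have h4 := h3.trans (mul_le_mul_of_nonneg_right (rpow_le_one_add_of_nonneg h0.le ht0 ht1)
      (Real.rpow_nonneg h2.le _))
    have e3 : (((2 * n + 1 + 1 : ℕ) : ℝ)) = j := by rw [hj]; push_cast; ring
    rw [show 2 * n + 1 + 1 + 1 = j + 1 by omega, e3, Real.rpow_neg h2.le, Real.rpow_neg h1.le]
    have p1 : 0 < a j ^ (1 / (4 * ((n : ℝ) + 1))) := Real.rpow_pos_of_pos h1 _
    have p2 : 0 < a (j + 1) ^ (1 / (2 * ((j : ℝ) + 1))) := Real.rpow_pos_of_pos h2 _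
    rw [← div_eq_mul_inv, le_div_iff₀ p1, inv_mul_le_iff₀ p2]
    exact h4.trans_eq (mul_comm _ _)

end LogConvex

section Functional

variable {A : Type*} [CommRing A] [Algebra ℝ A]

/-- The form on pairs of polynomials attached to a functional `N` and a base point `y`. -/
noncomputable def pairForm (N : A →ₗ[ℝ] ℝ) (y : A) :
    (Polynomial ℝ × Polynomial ℝ) →ₗ[ℝ] (Polynomial ℝ × Polynomial ℝ) →ₗ[ℝ] ℝ :=
  LinearMap.mk₂ ℝ (fun v w => N ((1 + y) * Polynomial.aeval y (v.1 * w.1 + Polynomial.X * (v.2 * w.2))))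
    (fun v v' w => by rw [← map_add, ← mul_add, ← map_add]; congr 3; simp; ring)
    (fun r v w => by
      rw [← map_smul, ← mul_smul_comm, ← map_smul]; congr 3; simp [smul_add])
    (fun v w w' => by rw [← map_add, ← mul_add, ← map_add]; congr 3; simp; ring)
    (fun r v w => by
      rw [← map_smul, ← mul_smul_comm, ← map_smul]; congr 3; simp [smul_add])

/-- The shift `(a, b) ↦ (X b, a)` on pairs of polynomials, i.e. multiplication by `√X`
on `a + √X b`. -/
noncomputable def pairShift : (Polynomial ℝ × Polynomial ℝ) →ₗ[ℝ] (Polynomial ℝ × Polynomial ℝ) where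
  toFun v := (Polynomial.X * v.2, v.1)
  map_add' v w := by simp [mul_add]
  map_smul' r v := by simp

/-- The parity involution on pairs of polynomials. -/
noncomputable def pairParity : (Polynomial ℝ × Polynomial ℝ) →ₗ[ℝ] (Polynomial ℝ × Polynomial ℝ) where
  toFun v := (v.1, -v.2)
  map_add' v w := by simp [add_comm]
  map_smul' r v := by simp

/-- Evaluation of `a + √X b` at `√X = γ i`, with `i` replaced by `1`. -/
noncomputable def pairEval (γ : ℝ) : (Polynomial ℝ × Polynomial ℝ) →ₗ[ℝ] ℝ where
  toFun v := v.1.eval (-γ ^ 2) + γ * v.2.eval (-γ ^ 2)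
  map_add' v w := by simp; ring
  map_smul' r v := by simp; ring

lemma pairForm_apply (N : A →ₗ[ℝ] ℝ) (y : A) (v w : Polynomial ℝ × Polynomial ℝ) :
    pairForm N y v w =
      N ((1 + y) * Polynomial.aeval y (v.1 * w.1 + Polynomial.X * (v.2 * w.2))) := rfl

lemma pairForm_self (N : A →ₗ[ℝ] ℝ) (y : A) (v : Polynomial ℝ × Polynomial ℝ) :
    pairForm N y v v = N (Polynomial.aeval y v.1 ^ 2) + N (y * Polynomial.aeval y v.1 ^ 2) +
      N (y * Polynomial.aeval y v.2 ^ 2) + N ((y * Polynomial.aeval y v.2) ^ 2) := by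
  rw [pairForm_apply, ← map_add, ← map_add, ← map_add]
  congr 1
  simp
  ring

lemma isOddSymmetric_pairForm {N : A →ₗ[ℝ] ℝ} {y : A} (h1 : ∀ p, 0 ≤ N (p ^ 2))
    (h2 : ∀ p, 0 ≤ N (y * p ^ 2)) : IsOddSymmetric (pairForm N y) pairShift pairParity where
  symm v w := by simp only [pairForm_apply]; congr 3; ring
  nonneg v := by
    rw [pairForm_self]
    have := h1 (Polynomial.aeval y v.1)
    have := h2 (Polynomial.aeval y v.1)
    have := h2 (Polynomial.aeval y v.2)
    have := h1 (y * Polynomial.aeval y v.2)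
    linarith
  selfAdjoint v w := by simp only [pairForm_apply, pairShift, LinearMap.coe_mk, AddHom.coe_mk]; congr 3; ring
  isometry v w := by simp [pairForm_apply, pairParity]
  odd v := by simp [pairShift, pairParity]

lemma pairForm_iterate (N : A →ₗ[ℝ] ℝ) (y : A) (n : ℕ) :
    pairForm N y ((pairShift ^ n) (1, 0)) ((pairShift ^ n) (1, 0)) = N ((1 + y) * y ^ n) := by
  have : ((pairShift ^ n) (1, 0)).1 * ((pairShift ^ n) (1, 0)).1 +
      Polynomial.X * (((pairShift ^ n) (1, 0)).2 * ((pairShift ^ n) (1, 0)).2) =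
      (Polynomial.X ^ n : Polynomial ℝ) := by
    induction n with
    | zero => simp
    | succ n ih =>
      rw [pow_succ', Module.End.mul_apply, pow_succ', ← ih]
      simp only [pairShift, LinearMap.coe_mk, AddHom.coe_mk]
      ring
  rw [pairForm_apply, this]
  simp

/-- Under Carleman's condition, `1` lies in the closure of the ideal generated by `c + y`. -/
lemma exists_approx_inverse_of_carleman {N : A →ₗ[ℝ] ℝ} {y : A} (h1 : ∀ p, 0 ≤ N (p ^ 2))
    (h2 : ∀ p, 0 ≤ N (y * p ^ 2))
    (hc : (∃ n : ℕ, N ((1 + y) * y ^ n) = 0) ∨ ¬ Summable fun n : ℕ =>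
      (N ((1 + y) * y ^ (n + 1))) ^ (-(1 / (2 * ((n : ℝ) + 1)))))
    {c : ℝ} (hc0 : 0 < c) {ε : ℝ} (hε : 0 < ε) :
    ∃ q : A, N ((1 - (algebraMap ℝ A c + y) * q) ^ 2) < ε := by
  have hγ := Real.sqrt_pos.2 hc0
  have hγ2 : √c ^ 2 = c := Real.sq_sqrt hc0.le
  set γ := √c
  obtain ⟨⟨a, b⟩, he, hw⟩ := exists_small_of_carleman (isOddSymmetric_pairForm h1 h2)
    (v := (1, 0)) (e := pairEval γ) (γ := γ) (ε := ε / (2 + 2 / c)) (by simp [pairParity]) hγ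
    (fun w => by simp [pairEval, pairShift, pairParity]; ring) (by simp [pairEval])
    (by simpa only [pairForm_iterate] using hc) (by positivity)
  simp only [pairEval, LinearMap.coe_mk, AddHom.coe_mk, hγ2] at he
  obtain ⟨Q, hQ⟩ : Polynomial.X - Polynomial.C (-c) ∣
      1 - (a - Polynomial.C γ⁻¹ * (Polynomial.X * b)) := by
    rw [Polynomial.dvd_iff_isRoot]
    simp only [Polynomial.IsRoot, Polynomial.eval_sub, Polynomial.eval_one, Polynomial.eval_mul,
      Polynomial.eval_C, Polynomial.eval_X]
    have : γ⁻¹ * (-c * b.eval (-c)) = -(γ * b.eval (-c)) := by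
      rw [← hγ2]; field_simp
    rw [this]; linarith
  refine ⟨Polynomial.aeval y Q, ?_⟩
  have h3 : 1 - (algebraMap ℝ A c + y) * Polynomial.aeval y Q =
      Polynomial.aeval y a - γ⁻¹ • (y * Polynomial.aeval y b) := by
    have := congrArg (Polynomial.aeval y) hQ
    simp only [map_sub, map_one, map_mul, Polynomial.aeval_X, Polynomial.aeval_C, map_neg] at this
    rw [Algebra.smul_def]
    linear_combination this
  rw [h3]
  rw [pairForm_self] at hw
  set α := Polynomial.aeval y a
  set β := y * Polynomial.aeval y b
  have h4 : N ((α - γ⁻¹ • β) ^ 2) + N ((α + γ⁻¹ • β) ^ 2) = 2 * N (α ^ 2) + 2 / c * N (β ^ 2) := by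
    have e2 : (2 / c) = 2 * (γ⁻¹ * γ⁻¹) := by rw [← hγ2]; field_simp
    rw [← map_add, e2, ← smul_eq_mul (2 * _), ← smul_eq_mul (2 : ℝ), ← map_smul, ← map_smul, ← map_add]
    congr 1
    simp only [Algebra.smul_def, map_mul]
    simp only [map_ofNat]
    ring
  have h5 := h1 (α + γ⁻¹ • β)
  have h6 := h2 α
  have h7 := h2 (Polynomial.aeval y b)
  have h8 := h1 α
  have h9 := h1 β
  rw [lt_div_iff₀ (by positivity)] at hw
  have h10 : 0 < 2 / c := by positivity
  dsimp only at hw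
  nlinarith [mul_nonneg h10.le h8, mul_nonneg h10.le h6, mul_nonneg h10.le h7, mul_nonneg h10.le h9]

end Functional

section Density

variable {A : Type*} [CommRing A] [Algebra ℝ A] {L : A →ₗ[ℝ] ℝ}

lemma map_mul_mul_sq_le {g : A} (hg : ∀ p, 0 ≤ L (g * p ^ 2)) (u v : A) :
    L (g * (u * v)) ^ 2 ≤ L (g * u ^ 2) * L (g * v ^ 2) := by
  have := sq_apply_le (B := LinearMap.mk₂ ℝ (fun u v => L (g * (u * v)))
    (fun u u' v => by rw [← map_add]; congr 1; ring)
    (fun r u v => by rw [← map_smul]; congr 1; simp)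
    (fun u v v' => by rw [← map_add]; congr 1; ring)
    (fun r u v => by rw [← map_smul]; congr 1; simp))
    (fun v w => by simp only [LinearMap.mk₂_apply, mul_comm v w])
    (fun v => by simpa only [LinearMap.mk₂_apply, sq] using hg v) u v
  simpa only [LinearMap.mk₂_apply, sq] using this

lemma map_mul_sq_le (h1 : ∀ p, 0 ≤ L (p ^ 2)) (u v : A) :
    L (u * v) ^ 2 ≤ L (u ^ 2) * L (v ^ 2) := by
  simpa using map_mul_mul_sq_le (L := L) (g := 1) (by simpa using h1) u v

lemma carleman_weighted {y : A} (h1 : ∀ p, 0 ≤ L (p ^ 2)) (h2 : ∀ p, 0 ≤ L (y * p ^ 2))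
    (hser : ∑' n : ℕ,
      (ENNReal.ofReal (L (y ^ (n + 1)))) ^ (-(1 / (2 * ((n : ℝ) + 1)))) = ⊤)
    {w : A} (hw1 : ∀ p, 0 ≤ L (w * p ^ 2)) (hw2 : ∀ p, 0 ≤ L (w * (y * p ^ 2))) :
    (∃ n : ℕ, L (w * ((1 + y) * y ^ n)) = 0) ∨ ¬ Summable fun n : ℕ =>
      (L (w * ((1 + y) * y ^ (n + 1)))) ^ (-(1 / (2 * ((n : ℝ) + 1)))) := by
  by_contra! hcon
  obtain ⟨hne, hs⟩ := hcon
  have hpos : ∀ n, 0 < L (w * ((1 + y) * y ^ n)) := fun n => by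
    refine lt_of_le_of_ne ?_ (hne n).symm
    obtain ⟨m, rfl | rfl⟩ := Nat.even_or_odd' n
    · have := add_nonneg (hw1 (y ^ m)) (hw2 (y ^ m))
      rw [← map_add] at this
      convert this using 2
      ring
    · have := add_nonneg (hw1 (y ^ (m + 1))) (hw2 (y ^ m))
      rw [← map_add] at this
      convert this using 2
      ring
  have hle : ∀ n, L (w * ((1 + y) * y ^ n)) ^ 2 ≤ L ((w * (1 + y)) ^ 2) * L (y ^ (2 * n)) := by
    intro n
    have := map_mul_sq_le h1 (w * (1 + y)) (y ^ n)
    rwa [← pow_mul, mul_comm n 2, mul_assoc] at this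
  have hmul : ∀ n, 0 < L ((w * (1 + y)) ^ 2) * L (y ^ (2 * n)) := fun n =>
    (pow_pos (hpos n) 2).trans_le (hle n)
  have hD : 0 < L ((w * (1 + y)) ^ 2) :=
    lt_of_le_of_ne (h1 _) fun h => by simpa [← h] using hmul 0
  set D := L ((w * (1 + y)) ^ 2)
  have heven : ∀ n, 0 < L (y ^ (2 * n)) := fun n => pos_of_mul_pos_right (hmul n) hD.le
  have hlc : ∀ n, L (y ^ (n + 1)) ^ 2 ≤ L (y ^ n) * L (y ^ (n + 2)) := by
    intro n
    obtain ⟨m, rfl | rfl⟩ := Nat.even_or_odd' n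
    · have := map_mul_sq_le h1 (y ^ m) (y ^ (m + 1))
      rwa [← pow_add, ← pow_mul, ← pow_mul, show m + (m + 1) = 2 * m + 1 by ring, mul_comm m 2,
        show (m + 1) * 2 = 2 * m + 2 by ring] at this
    · have := map_mul_mul_sq_le h2 (y ^ m) (y ^ (m + 1))
      rwa [← pow_add, ← pow_mul, ← pow_mul, ← pow_succ', ← pow_succ', ← pow_succ',
        show m + (m + 1) + 1 = 2 * m + 1 + 1 by ring, mul_comm m 2,
        show (m + 1) * 2 + 1 = 2 * m + 1 + 2 by ring] at this
  have ha : ∀ n, 0 < L (y ^ n) := fun n => by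
    obtain ⟨m, rfl | rfl⟩ := Nat.even_or_odd' n
    · exact heven m
    · refine lt_of_le_of_ne ?_ fun h => ?_
      · have := h2 (y ^ m)
        rwa [← pow_mul, ← pow_succ', mul_comm m 2] at this
      · have := hlc (2 * m + 1)
        rw [← h, zero_mul] at this
        exact absurd this (not_le.2 (pow_pos (heven (m + 1)) 2))
  have hsum : Summable fun n : ℕ => (L (y ^ (n + 1))) ^ (-(1 / (2 * ((n : ℝ) + 1)))) := by
    refine summable_of_summable_even (a := fun n => L (y ^ n)) ha hlc
      (Summable.of_nonneg_of_le (fun n => Real.rpow_nonneg (ha _).le _) (fun n => ?_)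
        (hs.mul_left (1 + D)))
    have hn : (0 : ℝ) ≤ n := Nat.cast_nonneg n
    set t : ℝ := 1 / (4 * ((n : ℝ) + 1)) with ht
    have ht0 : 0 ≤ t := by positivity
    have ht1 : t ≤ 1 := by rw [ht, div_le_one (by positivity)]; linarith
    have hsn := hpos (n + 1)
    have han := ha (2 * (n + 1))
    have h3 := Real.rpow_le_rpow (by positivity) (hle (n + 1)) ht0
    rw [Real.mul_rpow hD.le han.le, ← Real.rpow_natCast_mul hsn.le] at h3
    have e1 : ((2 : ℕ) : ℝ) * t = 1 / (2 * ((n : ℝ) + 1)) := by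
      rw [ht]; push_cast; field_simp; norm_num
    rw [e1] at h3
    have h4 := h3.trans (mul_le_mul_of_nonneg_right (rpow_le_one_add_of_nonneg hD.le ht0 ht1)
      (Real.rpow_nonneg han.le _))
    rw [Real.rpow_neg hsn.le, Real.rpow_neg han.le]
    rw [← div_eq_mul_inv, le_div_iff₀ (Real.rpow_pos_of_pos hsn _),
      inv_mul_le_iff₀ (Real.rpow_pos_of_pos han _)]
    exact h4.trans_eq (mul_comm _ _)
  refine hsum.tsum_ofReal_ne_top ?_
  rw [← hser]
  exact tsum_congr fun n => (ENNReal.ofReal_rpow_of_pos (ha _)).symm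

/-- The functional `L` is nonnegative on all `p ^ 2` and `y * p ^ 2` and satisfies Stieltjes'
condition for `y`. -/
structure IsStieltjes (L : A →ₗ[ℝ] ℝ) (y : A) : Prop where
  sq_nonneg : ∀ p, 0 ≤ L (p ^ 2)
  mul_sq_nonneg : ∀ p, 0 ≤ L (y * p ^ 2)
  tsum_eq_top : ∑' n : ℕ,
    (ENNReal.ofReal (L (y ^ (n + 1)))) ^ (-(1 / (2 * ((n : ℝ) + 1)))) = ⊤

lemma IsStieltjes.exists_approx_inverse {y : A} (h : IsStieltjes L y)
    {w : A} (hw1 : ∀ p, 0 ≤ L (w * p ^ 2)) (hw2 : ∀ p, 0 ≤ L (w * (y * p ^ 2)))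
    {c : ℝ} (hc : 0 < c) {ε : ℝ} (hε : 0 < ε) :
    ∃ q : A, L (w * (1 - (algebraMap ℝ A c + y) * q) ^ 2) < ε := by
  simpa using exists_approx_inverse_of_carleman (N := L ∘ₗ LinearMap.mulLeft ℝ w)
    (y := y) hw1 hw2 (carleman_weighted h.1 h.2 h.3 hw1 hw2) hc hε

end Density

section PosMul

variable {A : Type*} [CommRing A] [Algebra ℝ A] {L : A →ₗ[ℝ] ℝ} {y y' g g' : A}

/-- `PosMul L g` says that the functional `L` is nonnegative on `g` times any square. -/
def PosMul (L : A →ₗ[ℝ] ℝ) (g : A) : Prop := ∀ q, 0 ≤ L (g * q ^ 2)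

namespace PosMul

lemma map_nonneg (h : PosMul L g) : 0 ≤ L g := by simpa using h 1

lemma add (h : PosMul L g) (h' : PosMul L g') : PosMul L (g + g') := fun q => by
  rw [add_mul, map_add]; exact add_nonneg (h q) (h' q)

lemma smul (h : PosMul L g) {r : ℝ} (hr : 0 ≤ r) : PosMul L (r • g) := fun q => by
  rw [smul_mul_assoc, map_smul]; exact mul_nonneg hr (h q)

lemma zero : PosMul L 0 := fun q => by simp

lemma sum {ι : Type*} {s : Finset ι} {f : ι → A} (h : ∀ i ∈ s, PosMul L (f i)) :
    PosMul L (∑ i ∈ s, f i) :=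
  Finset.sum_induction f (PosMul L) (fun _ _ => add) zero h

lemma natCast_mul (h : PosMul L g) (n : ℕ) : PosMul L (n * g) := by
  have := h.smul (r := n) n.cast_nonneg
  rwa [Nat.cast_smul_eq_nsmul, nsmul_eq_mul] at this

lemma mul_sq (h : PosMul L g) (u : A) : PosMul L (g * u ^ 2) := fun q => by
  rw [mul_assoc, ← mul_pow]; exact h _

end PosMul

namespace IsStieltjes

lemma posMul_sq (h : IsStieltjes L y) (u : A) : PosMul L (u ^ 2) := fun q => by
  rw [← mul_pow]; exact h.sq_nonneg _

lemma posMul (h : IsStieltjes L y) : PosMul L y := h.mul_sq_nonneg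

/-- Nonnegativity on a square multiple of `1 + y` can be divided out. -/
lemma posMul_of_sq_mul (h : IsStieltjes L y) (hg : PosMul L ((1 + y) ^ 2 * g)) : PosMul L g := by
  intro q
  set f := g * q ^ 2 with hf
  by_contra! hneg
  have hL1 : 0 ≤ L 1 := by simpa using h.sq_nonneg 1
  set δ := min 1 (-L f / (2 * (L 1 + 2)))
  have hδ : 0 < δ := lt_min one_pos (div_pos (neg_pos.2 hneg) (by positivity))
  have hδ1 : δ ≤ 1 := min_le_left _ _
  have hδ2 : δ * (2 * (L 1 + 2)) ≤ -L f := by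
    rw [← le_div_iff₀ (by positivity)]; exact min_le_right _ _
  obtain ⟨r, hr⟩ := h.exists_approx_inverse (w := f ^ 2 + 1)
    (fun p => by
      have := add_nonneg (h.sq_nonneg (f * p)) (h.sq_nonneg p)
      rw [← map_add] at this
      exact this.trans_eq (congrArg L (by ring)))
    (fun p => by
      have := add_nonneg (h.mul_sq_nonneg (f * p)) (h.mul_sq_nonneg p)
      rw [← map_add] at this
      exact this.trans_eq (congrArg L (by ring))) one_pos (pow_pos hδ 2)
  rw [map_one] at hr
  set η := (1 + y) * r - 1 with hη
  have e1 : L ((f ^ 2 + 1) * (1 - (1 + y) * r) ^ 2) = L ((f * η) ^ 2) + L (η ^ 2) := by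
    rw [← map_add]; congr 1; rw [hη]; ring
  rw [e1] at hr
  have e2 : L ((1 + y) ^ 2 * g * (r * q) ^ 2) = L f + 2 * L (f * η) + L (f * η ^ 2) := by
    rw [two_mul, ← map_add, ← map_add, ← map_add]; congr 1; rw [hη, hf]; ring
  have e3 : L ((f * η - η) ^ 2) = L ((f * η) ^ 2) + L (η ^ 2) - L (f * η ^ 2) - L (f * η ^ 2) := by
    rw [← map_add, ← map_sub, ← map_sub]; congr 1; ring
  have e4 := map_mul_sq_le h.sq_nonneg (f * η) 1
  rw [mul_one, one_pow] at e4
  have p1 := hg (r * q)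
  have p2 := h.sq_nonneg (f * η - η)
  have p3 := h.sq_nonneg η
  have p4 := h.sq_nonneg (f * η)
  have p5 : L (f * η) ^ 2 ≤ δ ^ 2 * L 1 := e4.trans (by gcongr; linarith)
  have p6 : L (f * η) ≤ δ * (L 1 + 1) := by
    refine le_of_sq_le_sq (p5.trans ?_) (by positivity)
    rw [mul_pow]; gcongr; nlinarith
  nlinarith

lemma posMul_of_even_pow_mul (h : IsStieltjes L y) {n : ℕ} (hn : Even n)
    (hg : PosMul L ((1 + y) ^ n * g)) : PosMul L g := by
  obtain ⟨m, rfl⟩ := hn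
  induction m with
  | zero => simpa using hg
  | succ m ih =>
    refine ih (h.posMul_of_sq_mul ?_)
    convert hg using 1; ring

/-- The iteration `t ↦ t - t ^ 2` starting from `y / (1 + y) ^ 2`, with cleared denominators. -/
lemma exists_posMul_iterate (h : IsStieltjes L y) (h' : PosMul L y') (n : ℕ) :
    ∃ T S : A, PosMul L T ∧ PosMul L ((1 + y) ^ 2 ^ (n + 1) - (n + 1 : ℕ) * T) ∧
      PosMul L (y' * S) ∧ (1 + y) ^ 2 ^ (n + 1) * y = (1 + y) ^ 2 * (S + T) := by
  induction n with
  | zero =>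
    refine ⟨y, 0, h.posMul, ?_, by simpa using PosMul.zero, by simp⟩
    convert ((h.posMul_sq 1).add h.posMul).add (h.posMul_sq y) using 1
    push_cast; ring
  | succ n ih =>
    obtain ⟨T, S, hT, hb, hS, he⟩ := ih
    have hev : Even (2 ^ (n + 1)) := ⟨2 ^ n, by ring⟩
    have hZ : (1 + y) ^ 2 ^ (n + 1 + 1) = ((1 + y) ^ 2 ^ (n + 1)) ^ 2 := by
      rw [← pow_mul]; ring_nf
    obtain ⟨w, hw⟩ : ∃ w, (1 + y) ^ 2 ^ (n + 1) = w ^ 2 := ⟨(1 + y) ^ 2 ^ n, by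
      rw [← pow_mul]; ring_nf⟩
    have hcancel : ∀ g, PosMul L ((1 + y) ^ 2 ^ (n + 1) * g) → PosMul L g := fun g =>
      h.posMul_of_even_pow_mul hev
    set Z := (1 + y) ^ 2 ^ (n + 1)
    have hTb : PosMul L (T * (Z - (n + 1 : ℕ) * T)) := by
      apply hcancel
      convert ((hb.mul_sq T).natCast_mul (n + 1)).add (hT.mul_sq (Z - (n + 1 : ℕ) * T)) using 1
      ring
    refine ⟨T * (Z - T), Z * S + T ^ 2, ?_, ?_, ?_, ?_⟩
    · convert hTb.add (((h.posMul_sq T)).natCast_mul n) using 1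
      push_cast; ring
    · rw [hZ]
      convert ((h.posMul_sq (Z - (n + 1 : ℕ) * T)).add (h.posMul_sq T)).add (hTb.natCast_mul n)
        using 1
      push_cast; ring
    · convert (hS.mul_sq w).add (h'.mul_sq T) using 1
      rw [hw]; ring
    · rw [hZ]; linear_combination Z * he

/-- Stieltjes' condition for `y` makes `L` nonnegative on `y * y'` times any square as soon as it is
so on `y'`. -/
lemma posMul_mul (h : IsStieltjes L y) (h' : PosMul L y') : PosMul L (y * y') := by
  have key : ∀ n : ℕ, PosMul L ((4 * (n + 1) : ℕ) * (y * y') +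
      (2 * y' * (1 + y) ^ 2) ^ 2 + 1) := by
    intro n
    obtain ⟨T, S, hT, hb, hS, he⟩ := h.exists_posMul_iterate h' n
    have hev : Even (2 ^ (n + 1)) := ⟨2 ^ n, by ring⟩
    obtain ⟨w, hw⟩ : ∃ w, (1 + y) ^ 2 ^ (n + 1) = w ^ 2 := ⟨(1 + y) ^ 2 ^ n, by
      rw [← pow_mul]; ring_nf⟩
    have hcancel : ∀ g, PosMul L ((1 + y) ^ 2 ^ (n + 1) * g) → PosMul L g := fun g =>
      h.posMul_of_even_pow_mul hev
    set Z := (1 + y) ^ 2 ^ (n + 1)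
    have hTb : PosMul L (T * (Z - (n + 1 : ℕ) * T)) := by
      apply hcancel
      convert ((hb.mul_sq T).natCast_mul (n + 1)).add (hT.mul_sq (Z - (n + 1 : ℕ) * T)) using 1
      ring
    apply hcancel
    apply hcancel
    convert (((hS.mul_sq (w * (1 + y))).natCast_mul (4 * (n + 1))).add
      (h.posMul_sq (2 * Z * y' * (1 + y) ^ 2 + (n + 1 : ℕ) * T))).add
      ((h.posMul_sq (Z - (n + 1 : ℕ) * T)).add (hTb.natCast_mul (2 * (n + 1)))) using 1
    push_cast
    rw [mul_pow w, ← hw]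
    linear_combination (4 * (n + 1) * Z * y') * he
  intro q
  by_contra! hneg
  obtain ⟨n, hn⟩ := exists_nat_gt (L (((2 * y' * (1 + y) ^ 2) ^ 2 + 1) * q ^ 2) / -L (y * y' * q ^ 2))
  rw [div_lt_iff₀ (by linarith)] at hn
  have := key n q
  have e : ((4 * (n + 1) : ℕ) * (y * y') + (2 * y' * (1 + y) ^ 2) ^ 2 + 1) * q ^ 2 =
    (4 * (n + 1) : ℕ) • (y * y' * q ^ 2) + ((2 * y' * (1 + y) ^ 2) ^ 2 + 1) * q ^ 2 := by
    rw [nsmul_eq_mul]; ring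
  rw [e, map_add, map_nsmul, nsmul_eq_mul] at this
  push_cast at this
  nlinarith [(Nat.cast_nonneg n : (0 : ℝ) ≤ n)]

lemma posMul_pow_mul_pow (h : IsStieltjes L y) (h' : IsStieltjes L y') (i j : ℕ) :
    PosMul L (y ^ i * y' ^ j) := by
  have h1 : PosMul L (1 : A) := by simpa using h.posMul_sq 1
  obtain ⟨a, rfl | rfl⟩ := Nat.even_or_odd' i <;> obtain ⟨b, rfl | rfl⟩ := Nat.even_or_odd' j
  · convert h.posMul_sq (y ^ a * y' ^ b) using 1; ring
  · convert h'.posMul.mul_sq (y ^ a * y' ^ b) using 1; ring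
  · convert h.posMul.mul_sq (y ^ a * y' ^ b) using 1; ring
  · convert (h.posMul_mul h'.posMul).mul_sq (y ^ a * y' ^ b) using 1; ring

end IsStieltjes

end PosMul

section Bernstein

lemma abs_choose_div_choose_sub_pow_le {n d i : ℕ} (hi : i ≤ n + d) (m : ℕ) :
    ∀ a : ℕ, a + m = d →
      |((n + a).choose i : ℝ) / (n + d).choose i - (1 - i / (n + d : ℝ)) ^ m| ≤
        m * (d / (n + 1 : ℝ)) := by
  have hc : (0 : ℝ) < (n + d).choose i := by exact_mod_cast Nat.choose_pos hi
  induction m with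
  | zero =>
    rintro a rfl
    simp only [add_zero] at hc
    simp [div_self hc.ne']
  | succ m ih =>
    intro a had
    have hn : (0 : ℝ) ≤ n := n.cast_nonneg
    have hnd : (0 : ℝ) < n + d := by
      have : (1 : ℝ) ≤ d := by exact_mod_cast (show 1 ≤ d by omega)
      linarith
    have hir : (i : ℝ) ≤ n + d := by exact_mod_cast hi
    have h := ih (a + 1) (by omega)
    have hle : ((n + (a + 1)).choose i : ℝ) / (n + d).choose i ≤ 1 := by
      rw [div_le_one hc]
      exact_mod_cast Nat.choose_le_choose i (show n + (a + 1) ≤ n + d by omega)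
    have hge : 0 ≤ ((n + (a + 1)).choose i : ℝ) / (n + d).choose i := by positivity
    have hrec : ((n + a).choose i : ℝ) = (n + (a + 1)).choose i * (1 - i / (n + a + 1 : ℝ)) := by
      have e := Nat.choose_mul_succ_eq (n + a) i
      have hp : (n + a + 1 : ℝ) ≠ 0 := by positivity
      rcases le_or_gt i (n + a + 1) with hi' | hi'
      · have : (((n + a + 1 - i : ℕ)) : ℝ) = n + a + 1 - i := by
          rw [Nat.cast_sub hi']; push_cast; ring
        have e' : ((n + a).choose i : ℝ) * (n + a + 1) = (n + a + 1).choose i * (n + a + 1 - i) := by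
          rw [← this]; exact_mod_cast e
        rw [← add_assoc]
        field_simp
        linarith
      · rw [Nat.choose_eq_zero_of_lt (show n + a < i by omega),
          Nat.choose_eq_zero_of_lt (show n + (a + 1) < i by omega)]
        simp
    rw [hrec, mul_div_right_comm]
    set R := ((n + (a + 1)).choose i : ℝ) / (n + d).choose i
    set r := 1 - i / (n + d : ℝ) with hr
    have hr0 : 0 ≤ r := by rw [hr, sub_nonneg, div_le_one hnd]; exact hir
    have hr1 : r ≤ 1 := by rw [hr]; linarith [div_nonneg (Nat.cast_nonneg (α := ℝ) i) hnd.le]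
    have hdiff : |1 - i / (n + a + 1 : ℝ) - r| ≤ d / (n + 1 : ℝ) := by
      have hda : (d : ℝ) = a + m + 1 := by rw [← had]; push_cast; ring
      have e : 1 - i / (n + a + 1 : ℝ) - r = -((i / (n + d)) * (m / (n + a + 1))) := by
        rw [hr]
        field_simp
        rw [hda]; ring
      rw [e, abs_neg, abs_of_nonneg (by positivity)]
      calc i / (n + d : ℝ) * (m / (n + a + 1 : ℝ)) ≤ 1 * (m / (n + a + 1 : ℝ)) := by
            gcongr; rw [div_le_one hnd]; exact hir
        _ ≤ d / (n + 1 : ℝ) := by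
            rw [one_mul]; gcongr
            · omega
            · linarith [(Nat.cast_nonneg a : (0 : ℝ) ≤ a)]
    calc |R * (1 - i / (n + a + 1 : ℝ)) - r ^ (m + 1)|
        = |R * (1 - i / (n + a + 1 : ℝ) - r) + (R - r ^ m) * r| := by congr 1; ring
      _ ≤ |R * (1 - i / (n + a + 1 : ℝ) - r)| + |(R - r ^ m) * r| := abs_add_le _ _
      _ = R * |1 - i / (n + a + 1 : ℝ) - r| + |R - r ^ m| * r := by
          rw [abs_mul, abs_mul, abs_of_nonneg hge, abs_of_nonneg hr0]
      _ ≤ 1 * (d / (n + 1 : ℝ)) + (m * (d / (n + 1 : ℝ))) * 1 := by gcongr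
      _ = _ := by push_cast; ring

variable {ι : Type*} {s : Finset ι} {c : ι → ℝ} {a b : ι → ℕ} {d : ℕ}

lemma sum_mul_pow_nonneg (ha : ∀ t ∈ s, a t ≤ d) (hb : ∀ t ∈ s, b t ≤ d)
    (hF : ∀ u v : ℝ, 1 ≤ u → 1 ≤ v → 0 ≤ ∑ t ∈ s, c t * (u ^ a t * v ^ b t)) {x y : ℝ}
    (hx0 : 0 ≤ x) (hx1 : x ≤ 1) (hy0 : 0 ≤ y) (hy1 : y ≤ 1) :
    0 ≤ ∑ t ∈ s, c t * (x ^ (d - a t) * y ^ (d - b t)) := by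
  have key : ∀ x y : ℝ, 0 < x → x ≤ 1 → 0 < y → y ≤ 1 →
      0 ≤ ∑ t ∈ s, c t * (x ^ (d - a t) * y ^ (d - b t)) := by
    intro x y hx0 hx1 hy0 hy1
    have := mul_nonneg (show 0 ≤ x ^ d * y ^ d by positivity)
      (hF x⁻¹ y⁻¹ ((one_le_inv₀ hx0).2 hx1) ((one_le_inv₀ hy0).2 hy1))
    rw [Finset.mul_sum] at this
    refine this.trans_eq (Finset.sum_congr rfl fun t ht => ?_)
    rw [pow_sub₀ x hx0.ne' (ha t ht), pow_sub₀ y hy0.ne' (hb t ht), inv_pow, inv_pow]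
    ring
  have hcont : Filter.Tendsto (fun e : ℝ => ∑ t ∈ s, c t *
      (((1 - e) * x + e) ^ (d - a t) * ((1 - e) * y + e) ^ (d - b t))) (nhdsWithin 0 (Set.Ioi 0))
      (nhds (∑ t ∈ s, c t * (x ^ (d - a t) * y ^ (d - b t)))) := by
    have : Continuous (fun e : ℝ => ∑ t ∈ s, c t *
      (((1 - e) * x + e) ^ (d - a t) * ((1 - e) * y + e) ^ (d - b t))) := by fun_prop
    simpa using (this.tendsto 0).mono_left nhdsWithin_le_nhds
  refine ge_of_tendsto hcont ?_
  filter_upwards [Ioo_mem_nhdsGT (show (0 : ℝ) < 1 by norm_num)] with e he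
  obtain ⟨he0, he1⟩ := he
  exact key _ _ (by nlinarith) (by nlinarith) (by nlinarith) (by nlinarith)

lemma exists_sum_choose_nonneg (ha : ∀ t ∈ s, a t ≤ d) (hb : ∀ t ∈ s, b t ≤ d)
    (hF : ∀ u v : ℝ, 1 ≤ u → 1 ≤ v → 0 ≤ ∑ t ∈ s, c t * (u ^ a t * v ^ b t)) {ε : ℝ}
    (hε : 0 < ε) : ∃ N : ℕ, ∀ n ≥ N, ∀ i ≤ n + d, ∀ j ≤ n + d,
      0 ≤ ∑ t ∈ s, c t * ((n + a t).choose i * (n + b t).choose j) +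
        ε * ((n + d).choose i * (n + d).choose j) := by
  obtain ⟨N, hN⟩ := exists_nat_gt ((∑ t ∈ s, |c t|) * (2 * (d * d)) / ε)
  refine ⟨N, fun n hn i hi j hj => ?_⟩
  have hn0 : (0 : ℝ) ≤ n := n.cast_nonneg
  have hnN : (N : ℝ) ≤ n := by exact_mod_cast hn
  have hci : (0 : ℝ) < (n + d).choose i := by exact_mod_cast Nat.choose_pos hi
  have hcj : (0 : ℝ) < (n + d).choose j := by exact_mod_cast Nat.choose_pos hj
  have hunit : ∀ i ≤ n + d, 0 ≤ 1 - i / (n + d : ℝ) ∧ 1 - i / (n + d : ℝ) ≤ 1 := fun i hi => by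
    have hir : (i : ℝ) ≤ n + d := by exact_mod_cast hi
    have h1 : (i : ℝ) / (n + d) ≤ 1 := div_le_one_of_le₀ hir (by positivity)
    have h2 : 0 ≤ (i : ℝ) / (n + d) := by positivity
    constructor <;> linarith
  obtain ⟨hx0, hx1⟩ := hunit i hi
  obtain ⟨hy0, hy1⟩ := hunit j hj
  have happ : ∀ i ≤ n + d, ∀ e ≤ d, |((n + e).choose i : ℝ) / (n + d).choose i -
      (1 - i / (n + d : ℝ)) ^ (d - e)| ≤ d * d / (n + 1 : ℝ) := fun i hi e he => by
    refine (abs_choose_div_choose_sub_pow_le hi (d - e) e (by omega)).trans ?_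
    rw [mul_div_assoc]
    gcongr
    exact Nat.sub_le _ _
  have hG := sum_mul_pow_nonneg ha hb hF hx0 hx1 hy0 hy1
  set x := 1 - i / (n + d : ℝ)
  set y := 1 - j / (n + d : ℝ)
  have hterm : ∀ t ∈ s, -(|c t| * (2 * (d * d / (n + 1 : ℝ)))) ≤
      c t * (((n + a t).choose i / (n + d).choose i : ℝ) *
        ((n + b t).choose j / (n + d).choose j)) - c t * (x ^ (d - a t) * y ^ (d - b t)) := by
    intro t ht
    rw [← mul_sub]
    refine le_trans (neg_le_neg ?_) (neg_abs_le _)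
    rw [abs_mul]
    gcongr
    have h1 := happ i hi (a t) (ha t ht)
    have h2 := happ j hj (b t) (hb t ht)
    have h3 : ((n + a t).choose i / (n + d).choose i : ℝ) ≤ 1 := by
      rw [div_le_one hci]
      exact_mod_cast Nat.choose_le_choose i (Nat.add_le_add_left (ha t ht) n)
    have h4 : (0 : ℝ) ≤ ((n + a t).choose i / (n + d).choose i : ℝ) := by positivity
    have h5 : y ^ (d - b t) ≤ 1 := pow_le_one₀ hy0 hy1
    set R := ((n + a t).choose i / (n + d).choose i : ℝ)
    set R' := ((n + b t).choose j / (n + d).choose j : ℝ)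
    calc |R * R' - x ^ (d - a t) * y ^ (d - b t)|
        = |R * (R' - y ^ (d - b t)) + (R - x ^ (d - a t)) * y ^ (d - b t)| := by congr 1; ring
      _ ≤ |R * (R' - y ^ (d - b t))| + |(R - x ^ (d - a t)) * y ^ (d - b t)| := abs_add_le _ _
      _ = R * |R' - y ^ (d - b t)| + |R - x ^ (d - a t)| * y ^ (d - b t) := by
          rw [abs_mul, abs_mul, abs_of_nonneg h4, abs_of_nonneg (pow_nonneg hy0 _)]
      _ ≤ 1 * (d * d / (n + 1 : ℝ)) + (d * d / (n + 1 : ℝ)) * 1 := by gcongr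
      _ = _ := by ring
  have hsum := Finset.sum_le_sum hterm
  rw [Finset.sum_sub_distrib, Finset.sum_neg_distrib, ← Finset.sum_mul] at hsum
  have hsmall : (∑ t ∈ s, |c t|) * (2 * (d * d / (n + 1 : ℝ))) ≤ ε := by
    rw [← mul_div_assoc, ← mul_div_assoc, div_le_iff₀ (by positivity)]
    rw [div_lt_iff₀ hε] at hN
    nlinarith
  have hfin : 0 ≤ ((n + d).choose i * (n + d).choose j : ℝ) *
      (∑ t ∈ s, c t * (((n + a t).choose i / (n + d).choose i : ℝ) *
        ((n + b t).choose j / (n + d).choose j)) + ε) :=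
    mul_nonneg (by positivity) (by linarith)
  refine hfin.trans_eq ?_
  rw [mul_add, Finset.mul_sum]
  congr 1
  · refine Finset.sum_congr rfl fun t _ => ?_
    field_simp
  · ring

variable {A : Type*} [CommRing A] [Algebra ℝ A] {L : A →ₗ[ℝ] ℝ} {y y' g g' : A}

lemma one_add_pow_eq_sum (y : A) {m M : ℕ} (h : m ≤ M) :
    (1 + y) ^ m = ∑ i ∈ Finset.range (M + 1), (m.choose i : ℝ) • y ^ i := by
  rw [add_comm, add_pow]
  refine (Finset.sum_subset (Finset.range_mono (by omega)) fun i _ hi => ?_).trans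
    (Finset.sum_congr rfl fun i _ => ?_)
  · rw [Finset.mem_range, not_lt] at hi
    rw [Nat.choose_eq_zero_of_lt (by omega)]; simp
  · rw [Nat.cast_smul_eq_nsmul, nsmul_eq_mul, one_pow, mul_one, mul_comm]

lemma PosMul.of_forall_add_smul {h : A} (H : ∀ ε : ℝ, 0 < ε → PosMul L (g + ε • h)) :
    PosMul L g := by
  intro q
  have ht : Filter.Tendsto (fun ε : ℝ => L (g * q ^ 2) + ε * L (h * q ^ 2))
      (nhdsWithin 0 (Set.Ioi 0)) (nhds (L (g * q ^ 2))) := by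
    have : Continuous (fun ε : ℝ => L (g * q ^ 2) + ε * L (h * q ^ 2)) := by fun_prop
    simpa using (this.tendsto 0).mono_left nhdsWithin_le_nhds
  refine ge_of_tendsto ht ?_
  filter_upwards [self_mem_nhdsWithin] with ε hε
  have := H ε hε q
  rwa [add_mul, smul_mul_assoc, map_add, map_smul, smul_eq_mul] at this

/-- Positivity on the quadrant implies positivity of the functional. -/
lemma IsStieltjes.posMul_sum (h : IsStieltjes L y) (h' : IsStieltjes L y')
    (ha : ∀ t ∈ s, a t ≤ d) (hb : ∀ t ∈ s, b t ≤ d)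
    (hF : ∀ u v : ℝ, 1 ≤ u → 1 ≤ v → 0 ≤ ∑ t ∈ s, c t * (u ^ a t * v ^ b t)) :
    PosMul L (∑ t ∈ s, c t • ((1 + y) ^ a t * (1 + y') ^ b t)) := by
  refine PosMul.of_forall_add_smul (h := (1 + y) ^ d * (1 + y') ^ d) fun ε hε => ?_
  obtain ⟨N, hN⟩ := exists_sum_choose_nonneg ha hb hF hε
  apply h.posMul_of_even_pow_mul (n := 2 * N) ⟨N, by ring⟩
  apply h'.posMul_of_even_pow_mul (n := 2 * N) ⟨N, by ring⟩
  have hprod : ∀ p q : ℕ, p ≤ d → q ≤ d →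
      (1 + y') ^ (2 * N) * ((1 + y) ^ (2 * N) * ((1 + y) ^ p * (1 + y') ^ q)) =
      ∑ i ∈ Finset.range (2 * N + d + 1), ∑ j ∈ Finset.range (2 * N + d + 1),
        (((2 * N + p).choose i * (2 * N + q).choose j : ℝ)) • (y ^ i * y' ^ j) := by
    intro p q hp hq
    calc _ = (1 + y) ^ (2 * N + p) * (1 + y') ^ (2 * N + q) := by ring
      _ = _ := by
        rw [one_add_pow_eq_sum y (show 2 * N + p ≤ 2 * N + d by omega),
          one_add_pow_eq_sum y' (show 2 * N + q ≤ 2 * N + d by omega), Finset.sum_mul_sum]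
        simp_rw [smul_mul_smul_comm]
  have e : (1 + y') ^ (2 * N) * ((1 + y) ^ (2 * N) *
      (∑ t ∈ s, c t • ((1 + y) ^ a t * (1 + y') ^ b t) + ε • ((1 + y) ^ d * (1 + y') ^ d))) =
      ∑ i ∈ Finset.range (2 * N + d + 1), ∑ j ∈ Finset.range (2 * N + d + 1),
        (∑ t ∈ s, c t * ((2 * N + a t).choose i * (2 * N + b t).choose j) +
        ε * ((2 * N + d).choose i * (2 * N + d).choose j)) • (y ^ i * y' ^ j) := by
    simp_rw [add_smul, Finset.sum_smul, Finset.sum_add_distrib]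
    rw [mul_add, mul_add]
    congr 1
    · simp_rw [Finset.mul_sum, mul_smul_comm]
      rw [Finset.sum_congr rfl fun t ht => by rw [hprod _ _ (ha t ht) (hb t ht)]]
      simp_rw [Finset.smul_sum, smul_smul]
      rw [Finset.sum_comm]
      refine Finset.sum_congr rfl fun i _ => Finset.sum_comm
    · simp_rw [mul_smul_comm]
      rw [hprod _ _ le_rfl le_rfl]
      simp_rw [Finset.smul_sum, smul_smul]
  rw [e]
  refine PosMul.sum fun i hi => PosMul.sum fun j hj => (h.posMul_pow_mul_pow h' i j).smul ?_
  rw [Finset.mem_range] at hi hj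
  exact_mod_cast hN (2 * N) (by omega) i (by omega) j (by omega)

end Bernstein

section Curve

variable {k : ℕ} {L : MvPolynomial (Fin 2) ℝ →ₗ[ℝ] ℝ}

lemma map_nonneg_of_eval_nonneg (h : IsStieltjes L (X 0)) (h' : IsStieltjes L (X 1 - X 0 ^ k))
    {p : MvPolynomial (Fin 2) ℝ}
    (hp : ∀ x : Fin 2 → ℝ, 0 ≤ x 0 → 0 ≤ x 1 - x 0 ^ k → 0 ≤ eval x p) : 0 ≤ L p := by
  set P : MvPolynomial (Fin 2) ℝ :=
    aeval ![(X 0 - 1 : MvPolynomial (Fin 2) ℝ), X 1 - 1 + (X 0 - 1) ^ k] p with hP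
  have hpP : p = aeval ![1 + X 0, 1 + (X 1 - X 0 ^ k)] P := by
    have : (aeval ![1 + X 0, 1 + (X 1 - X 0 ^ k)] :
        MvPolynomial (Fin 2) ℝ →ₐ[ℝ] MvPolynomial (Fin 2) ℝ).comp
        (aeval ![(X 0 - 1 : MvPolynomial (Fin 2) ℝ), X 1 - 1 + (X 0 - 1) ^ k]) =
        AlgHom.id ℝ _ := by
      ext i : 1
      fin_cases i <;> simp
    exact (congrArg (fun φ : MvPolynomial (Fin 2) ℝ →ₐ[ℝ] MvPolynomial (Fin 2) ℝ => φ p) this).symm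
  have hle : ∀ i, ∀ t ∈ P.support, t i ≤ P.support.sup fun t => t 0 + t 1 := by
    intro i t ht
    refine le_trans ?_ (Finset.le_sup (f := fun t : Fin 2 →₀ ℕ => t 0 + t 1) ht)
    fin_cases i <;> simp
  have key := (h.posMul_sum h' (c := fun t => coeff t P) (hle 0) (hle 1) fun u v hu hv => by
    have := hp ![u - 1, v - 1 + (u - 1) ^ k] (by simpa using hu) (by simpa using hv)
    refine this.trans_eq ?_
    have e : eval ![u - 1, v - 1 + (u - 1) ^ k] p = eval ![u, v] P := by
      rw [hP, ← coe_aeval_eq_eval, ← coe_aeval_eq_eval]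
      have : (aeval ![u, v] : MvPolynomial (Fin 2) ℝ →ₐ[ℝ] ℝ).comp
          (aeval ![(X 0 - 1 : MvPolynomial (Fin 2) ℝ), X 1 - 1 + (X 0 - 1) ^ k]) =
          aeval ![u - 1, v - 1 + (u - 1) ^ k] := by
        ext i : 1
        fin_cases i <;> simp
      exact (congrArg (fun φ : MvPolynomial (Fin 2) ℝ →ₐ[ℝ] ℝ => φ p) this).symm
    rw [e, eval_eq']
    simp).map_nonneg
  refine key.trans_eq (congrArg L ?_)
  conv_rhs => rw [hpP, aeval_def, eval₂_eq']
  simp [Algebra.smul_def]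

end Curve

section Haviland

variable {σ : Type*} {K : Set (σ → ℝ)} {L : MvPolynomial σ ℝ →ₗ[ℝ] ℝ}

open CompactlySupported

lemma exists_extension_compactlySupported
    (hL : ∀ p : MvPolynomial σ ℝ, (∀ x ∈ K, 0 ≤ eval x p) → 0 ≤ L p) :
    ∃ Λ : C_c(K, ℝ) →ₚ[ℝ] ℝ, ∀ (p : MvPolynomial σ ℝ) (f : C_c(K, ℝ)),
      ((∀ x : K, f x ≤ eval x.1 p) → Λ f ≤ L p) ∧ ((∀ x : K, eval x.1 p ≤ f x) → L p ≤ Λ f) := by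
  let s : PointedCone ℝ (MvPolynomial σ ℝ × C_c(K, ℝ)) :=
    { carrier := {v | ∀ x : K, 0 ≤ eval x.1 v.1 + v.2 x}
      zero_mem' := by simp
      smul_mem' := fun ⟨c, hc⟩ v hv x => by
        have := mul_nonneg hc (hv x)
        rw [mul_add] at this
        simpa [Nonneg.mk_smul, smul_eval] using this
      add_mem' := fun {v w} hv hw x => by
        have := add_nonneg (hv x) (hw x)
        simp only [Prod.fst_add, Prod.snd_add, map_add, CompactlySupportedContinuousMap.coe_add,
          Pi.add_apply]
        linarith }
  obtain ⟨G, hG, hGs⟩ := riesz_extension s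
    ⟨LinearMap.ker (LinearMap.snd ℝ (MvPolynomial σ ℝ) C_c(K, ℝ)),
      (L ∘ₗ LinearMap.fst ℝ _ _).domRestrict _⟩
    (by
      rintro ⟨⟨p, f⟩, hf⟩ hs
      obtain rfl : f = 0 := hf
      exact hL p fun x hx => by simpa using hs ⟨x, hx⟩)
    (by
      rintro ⟨p, f⟩
      obtain ⟨M, hM⟩ := f.hasCompactSupport.exists_bound_of_continuous f.continuous
      refine ⟨⟨(C M - p, 0), rfl⟩, fun x => ?_⟩
      have := (abs_le.1 (hM x)).1
      simp
      linarith)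
  have hG' : ∀ p, G (p, 0) = L p := fun p => hG ⟨(p, 0), rfl⟩
  refine ⟨PositiveLinearMap.mk₀ (G ∘ₗ LinearMap.inr ℝ _ _) fun f hf => ?_, fun p f => ⟨fun h => ?_,
    fun h => ?_⟩⟩
  · exact hGs _ fun x => by simpa using hf x
  · have := hGs (p, -f) fun x => by simpa using h x
    have e : (p, -f) = (p, 0) - ((0, f) : MvPolynomial σ ℝ × C_c(K, ℝ)) := by simp
    rw [e, map_sub, hG'] at this
    change G (0, f) ≤ L p
    linarith
  · have := hGs (-p, f) fun x => by simpa using h x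
    have e : (-p, f) = ((0, f) : MvPolynomial σ ℝ × C_c(K, ℝ)) - (p, 0) := by simp
    rw [e, map_sub, hG'] at this
    change L p ≤ G (0, f)
    linarith

variable [Fintype σ]

/-- A compactly supported cutoff function on a closed subset of `σ → ℝ`. -/
noncomputable def cutoff (hK : IsClosed K) (p : MvPolynomial σ ℝ) (n : ℕ) : C_c(K, ℝ) where
  toFun x := eval x.1 p * max 0 (min 1 (n + 1 - ‖x.1‖))
  continuous_toFun := by
    have := MvPolynomial.continuous_eval p
    fun_prop
  hasCompactSupport' := by
    refine HasCompactSupport.intro (hK.isClosedEmbedding_subtypeVal.isCompact_preimage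
      (isCompact_closedBall (0 : σ → ℝ) (n + 1))) fun x hx => ?_
    simp only [Set.mem_preimage, Metric.mem_closedBall, dist_zero_right, not_le] at hx
    rw [max_eq_left, mul_zero]
    exact min_le_of_right_le (by linarith)

/-- **Haviland's theorem**: a functional that is nonnegative on polynomials nonnegative on a closed
set `K` is represented by a measure on `K`. -/
theorem exists_representingMeasure (hK : IsClosed K)
    (hL : ∀ p : MvPolynomial σ ℝ, (∀ x ∈ K, 0 ≤ eval x p) → 0 ≤ L p) :
    ∃ μ : Measure (σ → ℝ), μ Kᶜ = 0 ∧
      ∀ p : MvPolynomial σ ℝ, Integrable (fun x => eval x p) μ ∧ L p = ∫ x, eval x p ∂μ := by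
  obtain ⟨Λ, hΛ⟩ := exists_extension_compactlySupported hL
  have : LocallyCompactSpace K := hK.locallyCompactSpace
  set ν := RealRMK.rieszMeasure Λ
  set g : MvPolynomial σ ℝ := 1 + ∑ i, X i ^ 2 with hg
  have hgx : ∀ x : σ → ℝ, 1 + ‖x‖ ^ 2 ≤ eval x g := fun x => by
    have h0 : 0 ≤ ∑ i, x i ^ 2 := Finset.sum_nonneg fun i _ => sq_nonneg _
    have : ‖x‖ ≤ √(∑ i, x i ^ 2) := by
      rw [pi_norm_le_iff_of_nonneg (Real.sqrt_nonneg _)]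
      intro i
      refine Real.abs_le_sqrt ?_
      exact Finset.single_le_sum (f := fun i => x i ^ 2) (fun i _ => sq_nonneg _) (Finset.mem_univ i)
    have h2 := pow_le_pow_left₀ (norm_nonneg x) this 2
    rw [Real.sq_sqrt h0] at h2
    simpa [hg] using h2
  have key : ∀ p : MvPolynomial σ ℝ, (∀ x ∈ K, 0 ≤ eval x p) →
      Integrable (fun x : K => eval x.1 p) ν ∧ L p = ∫ x : K, eval x.1 p ∂ν := by
    intro p hp
    have hcont : Continuous fun x : K => eval x.1 p :=
      (MvPolynomial.continuous_eval p).comp continuous_subtype_val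
    have hnn : ∀ n (x : K), 0 ≤ cutoff hK p n x := fun n x =>
      mul_nonneg (hp x x.2) (le_max_left _ _)
    have hlint : ∀ n, ∫⁻ x, ENNReal.ofReal (cutoff hK p n x) ∂ν =
        ENNReal.ofReal (Λ (cutoff hK p n)) := fun n => by
      rw [← RealRMK.integral_rieszMeasure Λ, ofReal_integral_eq_lintegral_ofReal]
      · exact (cutoff hK p n).continuous.integrable_of_hasCompactSupport
          (cutoff hK p n).hasCompactSupport
      · exact Filter.Eventually.of_forall (hnn n)
    have hup : ∀ n, Λ (cutoff hK p n) ≤ L p := fun n => (hΛ p _).1 fun x =>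
      mul_le_of_le_one_right (hp x x.2) (max_le zero_le_one (min_le_left _ _))
    have hlow : ∀ n : ℕ, L p - L (p * g) * (1 / ((n : ℝ) + 1)) ≤ Λ (cutoff hK p n) := fun n => by
      have := (hΛ (p - (1 / ((n : ℝ) + 1)) • (p * g)) (cutoff hK p n)).2 fun x => by
        have h1 := hgx x.1
        have hn : (0 : ℝ) ≤ n := n.cast_nonneg
        change _ ≤ eval x.1 p * max 0 (min 1 (n + 1 - ‖x.1‖))
        rw [map_sub, smul_eval, map_mul]
        have : 1 - (1 / ((n : ℝ) + 1)) * eval x.1 g ≤ max 0 (min 1 (n + 1 - ‖x.1‖)) := by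
          rcases le_or_gt ‖x.1‖ n with h | h
          · rw [min_eq_left (by linarith), max_eq_right zero_le_one]
            have : 0 ≤ eval x.1 g := by nlinarith [sq_nonneg ‖x.1‖]
            have : 0 ≤ 1 / ((n : ℝ) + 1) * eval x.1 g := by positivity
            linarith
          · refine le_max_of_le_left ?_
            have hnn : (n : ℝ) ≤ n * n := by exact_mod_cast Nat.le_mul_self n
            have : (n : ℝ) + 1 ≤ eval x.1 g := by nlinarith
            have : 1 ≤ 1 / ((n : ℝ) + 1) * eval x.1 g := by
              rw [one_div, inv_mul_eq_div, one_le_div (by positivity)]; exact this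
            linarith
        have := mul_le_mul_of_nonneg_left this (hp x x.2)
        linarith
      rw [map_sub, map_smul, smul_eq_mul] at this
      linarith
    have hlim : Filter.Tendsto (fun n => Λ (cutoff hK p n)) Filter.atTop (nhds (L p)) := by
      refine tendsto_of_tendsto_of_tendsto_of_le_of_le ?_ tendsto_const_nhds hlow hup
      simpa using tendsto_const_nhds.sub
        ((tendsto_one_div_add_atTop_nhds_zero_nat (𝕜 := ℝ)).const_mul (L (p * g)))
    have hmono := lintegral_tendsto_of_tendsto_of_monotone (μ := ν)
      (f := fun n x => ENNReal.ofReal (cutoff hK p n x)) (F := fun x => ENNReal.ofReal (eval x.1 p))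
      (fun n => (cutoff hK p n).continuous.measurable.ennreal_ofReal.aemeasurable)
      (Filter.Eventually.of_forall fun x m n hmn => ENNReal.ofReal_le_ofReal (by
        change eval x.1 p * max 0 (min 1 (m + 1 - ‖x.1‖)) ≤
          eval x.1 p * max 0 (min 1 (n + 1 - ‖x.1‖))
        have := hp x x.2
        gcongr))
      (Filter.Eventually.of_forall fun x => by
        refine tendsto_const_nhds.congr' ?_
        obtain ⟨N, hN⟩ := exists_nat_ge ‖x.1‖
        filter_upwards [Filter.eventually_ge_atTop N] with n hn
        change _ = ENNReal.ofReal (eval x.1 p * max 0 (min 1 (n + 1 - ‖x.1‖)))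
        have : (N : ℝ) ≤ n := by exact_mod_cast hn
        rw [min_eq_left (by linarith), max_eq_right zero_le_one, mul_one])
    simp only [hlint] at hmono
    have hval := tendsto_nhds_unique hmono ((ENNReal.continuous_ofReal.tendsto _).comp hlim)
    have hae : 0 ≤ᵐ[ν] fun x : K => eval x.1 p := Filter.Eventually.of_forall fun x => hp x x.2
    refine ⟨⟨hcont.aestronglyMeasurable, ?_⟩, ?_⟩
    · rw [hasFiniteIntegral_iff_ofReal hae, hval]
      exact ENNReal.ofReal_lt_top
    · rw [integral_eq_lintegral_of_nonneg_ae hae hcont.aestronglyMeasurable, hval,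
        ENNReal.toReal_ofReal (hL p hp)]
  have hemb : MeasurableEmbedding ((↑) : K → σ → ℝ) := MeasurableEmbedding.subtype_coe hK.measurableSet
  refine ⟨ν.map (↑), ?_, fun p => ?_⟩
  · rw [hemb.map_apply]
    simp
  · rw [hemb.integrable_map_iff, hemb.integral_map]
    obtain ⟨h1, h2⟩ := key (p ^ 2 + p + 1) fun x _ => by
      simp only [map_add, map_pow, map_one]; nlinarith [sq_nonneg (eval x p + 1)]
    obtain ⟨h3, h4⟩ := key (p ^ 2 + 1) fun x _ => by
      simp only [map_add, map_pow, map_one]; positivity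
    have e : ∀ x : K, eval x.1 p = eval x.1 (p ^ 2 + p + 1) - eval x.1 (p ^ 2 + 1) := fun x => by
      simp only [map_add, map_pow, map_one]; ring
    refine ⟨(h1.sub h3).congr (Filter.Eventually.of_forall fun x => (e x).symm), ?_⟩
    simp_rw [e]
    rw [integral_sub h1 h3, ← h2, ← h4, ← map_sub]
    congr 1; ring

end Haviland

section Determinacy

variable {σ : Type*} {L : MvPolynomial σ ℝ →ₗ[ℝ] ℝ} {y : MvPolynomial σ ℝ}

open scoped BoundedContinuousFunction

/-- A measure representing a functional on polynomials. -/
structure IsRepresenting (L : MvPolynomial σ ℝ →ₗ[ℝ] ℝ) (μ : Measure (σ → ℝ)) : Prop where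
  integrable : ∀ p, Integrable (fun x => eval x p) μ
  integral_eq : ∀ p, L p = ∫ x, eval x p ∂μ

namespace IsRepresenting

variable {μ μ' : Measure (σ → ℝ)}

lemma isFiniteMeasure (h : IsRepresenting L μ) : IsFiniteMeasure μ := by
  have := h.integrable 1
  simp only [map_one] at this
  exact (integrable_const_iff_isFiniteMeasure one_ne_zero).1 this

variable [Fintype σ]

lemma real_abs_add_lt_le (h : IsRepresenting L μ) (hy : IsStieltjes L y) {c δ : ℝ} (hc : 0 < c)
    (hδ : 0 < δ) : μ.real {x | |eval x y + c| < δ} ≤ 4 * L 1 * δ ^ 2 / c ^ 2 := by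
  have := h.isFiniteMeasure
  have key : ∀ ε > 0, μ.real {x | |eval x y + c| < δ} ≤
      2 * ε + 2 * δ ^ 2 * ((2 * L 1 + 2 * ε) / c ^ 2) := by
    intro ε hε
    obtain ⟨q, hq⟩ := hy.exists_approx_inverse (w := 1) (by simpa using hy.sq_nonneg)
      (by simpa using hy.mul_sq_nonneg) hc hε
    rw [one_mul, algebraMap_eq] at hq
    have h1 : L (q ^ 2) ≤ (2 * L 1 + 2 * ε) / c ^ 2 := by
      rw [le_div_iff₀ (by positivity)]
      have e1 : L (((C c + y) * q) ^ 2) =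
          c ^ 2 * L (q ^ 2) + 2 * c * L (y * q ^ 2) + L ((y * q) ^ 2) := by
        rw [← smul_eq_mul (c ^ 2), ← smul_eq_mul (2 * c), ← map_smul, ← map_smul, ← map_add,
          ← map_add]
        congr 1
        simp only [smul_eq_C_mul, map_mul, map_pow, map_ofNat]
        ring
      have e2 : L (((C c + y) * q) ^ 2) + L ((2 - (C c + y) * q) ^ 2) =
          2 * L 1 + 2 * L ((1 - (C c + y) * q) ^ 2) := by
        rw [two_mul, two_mul, ← map_add, ← map_add, ← map_add, ← map_add]
        congr 1
        ring
      have e3 := hy.sq_nonneg (2 - (C c + y) * q)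
      have e4 := hy.mul_sq_nonneg q
      have e5 := hy.sq_nonneg (y * q)
      nlinarith [mul_nonneg hc.le e4]
    have hmeas : MeasurableSet {x : σ → ℝ | |eval x y + c| < δ} :=
      (isOpen_lt (by have := MvPolynomial.continuous_eval y; fun_prop)
        continuous_const).measurableSet
    have h2 : μ.real {x | |eval x y + c| < δ} ≤
        ∫ x, eval x ((2 : ℝ) • (1 - (C c + y) * q) ^ 2 + (2 * δ ^ 2) • q ^ 2) ∂μ := by
      rw [← integral_indicator_one hmeas]
      refine integral_mono ((integrable_indicator_iff hmeas).2 (integrable_const _).integrableOn)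
        (h.integrable _) fun x => ?_
      simp only [map_add, smul_eval, map_pow, map_sub, map_mul, map_one, eval_C]
      refine Set.indicator_apply_le' (fun hx => ?_) fun _ => by positivity
      have hx' : (c + eval x y) ^ 2 ≤ δ ^ 2 := by
        obtain ⟨hl, hr⟩ := abs_lt.1 (show |eval x y + c| < δ from hx)
        exact sq_le_sq' (by linarith) (by linarith)
      have := mul_le_mul_of_nonneg_right hx' (sq_nonneg (eval x q))
      simp only [Pi.one_apply]
      nlinarith [sq_nonneg (1 - 2 * ((c + eval x y) * eval x q))]
    rw [← h.integral_eq, map_add, map_smul, map_smul, smul_eq_mul, smul_eq_mul] at h2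
    have := mul_le_mul_of_nonneg_left h1 (show 0 ≤ 2 * δ ^ 2 by positivity)
    linarith
  have ht : Filter.Tendsto (fun ε : ℝ => 2 * ε + 2 * δ ^ 2 * ((2 * L 1 + 2 * ε) / c ^ 2))
      (nhdsWithin 0 (Set.Ioi 0)) (nhds (4 * L 1 * δ ^ 2 / c ^ 2)) := by
    have : Continuous (fun ε : ℝ => 2 * ε + 2 * δ ^ 2 * ((2 * L 1 + 2 * ε) / c ^ 2)) := by fun_prop
    convert (this.tendsto 0).mono_left nhdsWithin_le_nhds using 2
    ring
  exact ge_of_tendsto ht (by filter_upwards [self_mem_nhdsWithin] with ε hε using key ε hε)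

lemma real_Icc_eq_zero (h : IsRepresenting L μ) (hy : IsStieltjes L y) {a b : ℝ} (ha : 0 < a)
    (hab : a < b) : μ.real {x | a ≤ -eval x y ∧ -eval x y ≤ b} = 0 := by
  have := h.isFiniteMeasure
  have hL1 : 0 ≤ L 1 := by simpa using hy.sq_nonneg 1
  have key : ∀ n : ℕ, μ.real {x | a ≤ -eval x y ∧ -eval x y ≤ b} ≤
      8 * L 1 * (b - a) ^ 2 / a ^ 2 * (1 / ((n : ℝ) + 1)) := by
    intro n
    have hn : (0 : ℝ) < (n : ℝ) + 1 := by positivity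
    set δ := (b - a) / ((n : ℝ) + 1) with hδ
    have hδ0 : 0 < δ := div_pos (by linarith) hn
    have hsub : {x | a ≤ -eval x y ∧ -eval x y ≤ b} ⊆
        ⋃ k ∈ Finset.range (n + 2), {x | |eval x y + (a + k * δ)| < δ} := by
      rintro x ⟨hx1, hx2⟩
      have h0 : 0 ≤ (-eval x y - a) / δ := div_nonneg (by linarith) hδ0.le
      have hfl := Nat.floor_le h0
      have hlt := Nat.lt_floor_add_one ((-eval x y - a) / δ)
      rw [le_div_iff₀ hδ0] at hfl
      rw [div_lt_iff₀ hδ0] at hlt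
      simp only [Set.mem_iUnion, Finset.mem_range, Set.mem_ofPred_eq]
      refine ⟨⌊(-eval x y - a) / δ⌋₊, ?_, ?_⟩
      · have : (-eval x y - a) / δ ≤ (n + 1 : ℕ) := by
          rw [div_le_iff₀ hδ0, hδ]; push_cast; field_simp; linarith
        have := Nat.floor_le_of_le this
        omega
      · rw [abs_lt]; constructor <;> linarith
    calc μ.real {x | a ≤ -eval x y ∧ -eval x y ≤ b}
        ≤ μ.real (⋃ k ∈ Finset.range (n + 2), {x | |eval x y + (a + k * δ)| < δ}) :=
          measureReal_mono hsub (measure_ne_top _ _)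
      _ ≤ ∑ k ∈ Finset.range (n + 2), μ.real {x | |eval x y + (a + k * δ)| < δ} :=
          measureReal_biUnion_finset_le _ _
      _ ≤ ∑ k ∈ Finset.range (n + 2), 4 * L 1 * δ ^ 2 / a ^ 2 := by
          refine Finset.sum_le_sum fun k _ => ?_
          have hk : 0 ≤ (k : ℝ) * δ := by positivity
          refine (h.real_abs_add_lt_le hy (by linarith) hδ0).trans ?_
          gcongr
          linarith
      _ = (n + 2) * (4 * L 1 * δ ^ 2 / a ^ 2) := by simp
      _ ≤ (2 * (n + 1)) * (4 * L 1 * δ ^ 2 / a ^ 2) := by gcongr; linarith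
      _ = _ := by rw [hδ]; field_simp; ring
  have ht : Filter.Tendsto (fun n : ℕ => 8 * L 1 * (b - a) ^ 2 / a ^ 2 * (1 / ((n : ℝ) + 1)))
      Filter.atTop (nhds 0) := by
    simpa only [mul_zero] using (tendsto_one_div_add_atTop_nhds_zero_nat (𝕜 := ℝ)).const_mul
      (8 * L 1 * (b - a) ^ 2 / a ^ 2)
  exact le_antisymm (ge_of_tendsto ht (Filter.Eventually.of_forall key)) measureReal_nonneg

/-- Stieltjes' condition for `y` forces every representing measure to live on `{0 ≤ y}`. -/
lemma ae_eval_nonneg (h : IsRepresenting L μ) (hy : IsStieltjes L y) :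
    ∀ᵐ x ∂μ, 0 ≤ eval x y := by
  have := h.isFiniteMeasure
  have hn : ∀ n : ℕ, μ {x | 1 / ((n : ℝ) + 1) ≤ -eval x y ∧ -eval x y ≤ n + 2} = 0 := fun n => by
    rw [← measureReal_eq_zero_iff]
    refine h.real_Icc_eq_zero hy (by positivity) ?_
    have hn : (0 : ℝ) ≤ n := n.cast_nonneg
    rw [div_lt_iff₀ (by positivity)]
    nlinarith
  rw [ae_iff]
  refine measure_mono_null (fun x hx => ?_) (measure_iUnion_null hn)
  simp only [Set.mem_ofPred_eq, not_le] at hx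
  obtain ⟨n, hn⟩ := exists_nat_one_div_lt (neg_pos.2 hx)
  obtain ⟨m, hm⟩ := exists_nat_ge (-eval x y)
  refine Set.mem_iUnion.2 ⟨max n m, ?_, ?_⟩
  · refine le_trans (one_div_le_one_div_of_le (by positivity) ?_) hn.le
    have : (n : ℝ) ≤ (max n m : ℕ) := by exact_mod_cast le_max_left _ _
    linarith
  · have : (m : ℝ) ≤ (max n m : ℕ) := by exact_mod_cast le_max_right _ _
    linarith

lemma integrable_mul (h : IsRepresenting L μ) (u : (σ → ℝ) →ᵇ ℝ) (p : MvPolynomial σ ℝ) :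
    Integrable (fun x => u x * eval x p) μ :=
  (h.integrable p).bdd_mul u.continuous.aestronglyMeasurable
    (Filter.Eventually.of_forall u.norm_coe_le_norm)

end IsRepresenting

lemma abs_one_sub_div_one_add_abs_le (s : ℝ) : |1 - s / (1 + |s|)| ≤ 2 := by
  have h : |s / (1 + |s|)| ≤ 1 := by
    rw [abs_div, abs_of_pos (show 0 < 1 + |s| by positivity), div_le_one (by positivity)]
    linarith
  rw [abs_le] at h ⊢
  constructor <;> linarith

/-- A bounded continuous injective function of `y` equal to `1 / (1 + y)` where `0 ≤ y`. -/
noncomputable def shiftedInv (y : MvPolynomial σ ℝ) : (σ → ℝ) →ᵇ ℝ :=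
  BoundedContinuousFunction.ofNormedAddCommGroup (fun x => 1 - eval x y / (1 + |eval x y|))
    (by
      have := MvPolynomial.continuous_eval y
      exact continuous_const.sub (this.div (by fun_prop) fun x => by positivity)) 2
    fun x => abs_one_sub_div_one_add_abs_le (eval x y)

lemma shiftedInv_apply (y : MvPolynomial σ ℝ) (x : σ → ℝ) :
    shiftedInv y x = 1 - eval x y / (1 + |eval x y|) := rfl

lemma abs_shiftedInv_le (y : MvPolynomial σ ℝ) (x : σ → ℝ) : |shiftedInv y x| ≤ 2 :=
  abs_one_sub_div_one_add_abs_le (eval x y)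

lemma eval_eq_of_shiftedInv_eq {y : MvPolynomial σ ℝ} {x x' : σ → ℝ}
    (h : shiftedInv y x = shiftedInv y x') : eval x y = eval x' y := by
  rw [shiftedInv_apply, shiftedInv_apply] at h
  have h : eval x y / (1 + |eval x y|) = eval x' y / (1 + |eval x' y|) := by linarith
  set s := eval x y
  set t := eval x' y
  rw [div_eq_div_iff (by positivity) (by positivity)] at h
  rcases abs_cases s with ⟨hs, hs'⟩ | ⟨hs, hs'⟩ <;> rcases abs_cases t with ⟨ht, ht'⟩ | ⟨ht, ht'⟩ <;>
    rw [hs, ht] at h <;> nlinarith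

namespace IsRepresenting

variable [Fintype σ] {μ μ' : Measure (σ → ℝ)}

lemma abs_integral_shiftedInv_sub_le (h : IsRepresenting L μ) (hy : IsStieltjes L y)
    (u : (σ → ℝ) →ᵇ ℝ) (p : MvPolynomial σ ℝ) {δ : ℝ} (hδ : 0 < δ) {q : MvPolynomial σ ℝ}
    (hq : L (p ^ 2 * (1 - (C 1 + y) * q) ^ 2) < δ ^ 2) :
    |∫ x, (u * shiftedInv y) x * eval x p ∂μ - ∫ x, u x * eval x (p * q) ∂μ| ≤
      ‖u‖ * δ * (L 1 + 1) := by
  have hb : ∀ᵐ x ∂μ, ‖(u * shiftedInv y) x * eval x p - u x * eval x (p * q)‖ ≤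
      eval x ((‖u‖ * δ) • 1 + (‖u‖ * δ⁻¹) • (p ^ 2 * (1 - (C 1 + y) * q) ^ 2) :
        MvPolynomial σ ℝ) := by
    filter_upwards [h.ae_eval_nonneg hy] with x hx
    have hinv : shiftedInv y x * (1 + eval x y) = 1 := by
      rw [shiftedInv_apply, abs_of_nonneg hx]
      field_simp
      ring
    have e : (u * shiftedInv y) x * eval x p - u x * eval x (p * q) =
        u x * (shiftedInv y x * (eval x p * (1 - (1 + eval x y) * eval x q))) := by
      rw [BoundedContinuousFunction.mul_apply, map_mul]
      linear_combination (u x * eval x p * eval x q) * hinv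
    have hu := u.norm_coe_le_norm x
    have hr := abs_shiftedInv_le y x
    rw [e]
    simp only [map_add, smul_eval, map_mul, map_pow, map_sub, map_one, mul_one]
    set v := eval x p * (1 - (1 + eval x y) * eval x q)
    calc ‖u x * (shiftedInv y x * v)‖ = ‖u x‖ * (|shiftedInv y x| * |v|) := by
          rw [norm_mul, norm_mul, Real.norm_eq_abs (shiftedInv y x), Real.norm_eq_abs v]
      _ ≤ ‖u‖ * (2 * |v|) := by gcongr
      _ ≤ ‖u‖ * (δ + δ⁻¹ * v ^ 2) := by
          gcongr
          have := mul_nonneg (inv_pos.2 hδ).le (sq_nonneg (δ - |v|))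
          rw [show δ⁻¹ * (δ - |v|) ^ 2 = δ⁻¹ * δ * δ - 2 * (δ⁻¹ * δ) * |v| + δ⁻¹ * |v| ^ 2 by ring,
            inv_mul_cancel₀ hδ.ne', sq_abs] at this
          linarith
      _ = _ := by ring
  rw [← integral_sub (h.integrable_mul _ _) (h.integrable_mul _ _), ← Real.norm_eq_abs]
  refine (norm_integral_le_of_norm_le (h.integrable _) hb).trans ?_
  rw [← h.integral_eq, map_add, map_smul, map_smul, smul_eq_mul, smul_eq_mul]
  have := mul_le_mul_of_nonneg_left hq.le (show 0 ≤ ‖u‖ * δ⁻¹ by positivity)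
  rw [show ‖u‖ * δ⁻¹ * δ ^ 2 = ‖u‖ * δ * (δ⁻¹ * δ) by ring, inv_mul_cancel₀ hδ.ne'] at this
  linarith

lemma integral_mul_shiftedInv_eq (h : IsRepresenting L μ) (h' : IsRepresenting L μ')
    (hy : IsStieltjes L y) {u : (σ → ℝ) →ᵇ ℝ}
    (hu : ∀ p, ∫ x, u x * eval x p ∂μ = ∫ x, u x * eval x p ∂μ') (p : MvPolynomial σ ℝ) :
    ∫ x, (u * shiftedInv y) x * eval x p ∂μ = ∫ x, (u * shiftedInv y) x * eval x p ∂μ' := by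
  have hL1 : 0 ≤ L 1 := by simpa using hy.sq_nonneg 1
  rw [← sub_eq_zero, ← abs_nonpos_iff]
  refine le_of_forall_pos_le_add fun ε hε => ?_
  set δ := ε / (2 * (‖u‖ + 1) * (L 1 + 1)) with hδdef
  have hδ : 0 < δ := by positivity
  obtain ⟨q, hq⟩ := hy.exists_approx_inverse (w := p ^ 2)
    (fun r => by rw [← mul_pow]; exact hy.sq_nonneg _)
    (fun r => by
      rw [show p ^ 2 * (y * r ^ 2) = y * (p * r) ^ 2 by ring]; exact hy.mul_sq_nonneg _)
    one_pos (pow_pos hδ 2)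
  rw [algebraMap_eq] at hq
  have h1 := h.abs_integral_shiftedInv_sub_le hy u p hδ hq
  have h2 := h'.abs_integral_shiftedInv_sub_le hy u p hδ hq
  rw [hu] at h1
  have h3 : ‖u‖ * δ * (L 1 + 1) ≤ ε / 2 := by
    calc ‖u‖ * δ * (L 1 + 1) ≤ (‖u‖ + 1) * δ * (L 1 + 1) := by gcongr; linarith
      _ = ε / 2 := by rw [hδdef]; field_simp
  rw [abs_le] at h1 h2 ⊢
  constructor <;> linarith

/-- Determinacy: if a family of polynomials satisfying Stieltjes' condition separates points, then
there is at most one representing measure. -/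
theorem eq_of_isStieltjes {ι : Type*} {y : ι → MvPolynomial σ ℝ}
    (hy : ∀ i, IsStieltjes L (y i))
    (hinj : ∀ x x' : σ → ℝ, (∀ i, eval x (y i) = eval x' (y i)) → x = x')
    (h : IsRepresenting L μ) (h' : IsRepresenting L μ') : μ = μ' := by
  have := h.isFiniteMeasure
  have := h'.isFiniteMeasure
  let S : StarSubalgebra ℝ ((σ → ℝ) →ᵇ ℝ) :=
    { Algebra.adjoin ℝ (Set.range fun i => shiftedInv (y i)) with
      star_mem' := fun {a} ha => by
        rwa [show star a = a by ext; simp] }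
  refine ext_of_forall_mem_subalgebra_integral_eq_of_polish (𝕜 := ℝ) (A := S) ?_ ?_
  · intro x x' hne
    by_contra! hcon
    refine hne (hinj x x' fun i => eval_eq_of_shiftedInv_eq ?_)
    exact hcon _ ⟨_, ⟨shiftedInv (y i), Algebra.subset_adjoin ⟨i, rfl⟩, rfl⟩, rfl⟩
  · have key : ∀ v ∈ Algebra.adjoin ℝ (Set.range fun i => shiftedInv (y i)),
        ∀ u : (σ → ℝ) →ᵇ ℝ, (∀ p, ∫ x, u x * eval x p ∂μ = ∫ x, u x * eval x p ∂μ') →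
          ∀ p, ∫ x, (u * v) x * eval x p ∂μ = ∫ x, (u * v) x * eval x p ∂μ' := by
      intro v hv
      induction hv using Algebra.adjoin_induction with
      | mem v hv =>
        obtain ⟨i, rfl⟩ := hv
        exact fun u hu => h.integral_mul_shiftedInv_eq h' (hy i) hu
      | algebraMap r =>
        intro u hu p
        have e : ∀ x, (u * algebraMap ℝ _ r) x * eval x p = r * (u x * eval x p) := fun x => by
          rw [BoundedContinuousFunction.mul_apply, BoundedContinuousFunction.algebraMap_apply]
          simp
          ring
        simp_rw [e, integral_const_mul, hu]
      | add v w _ _ hv hw =>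
        intro u hu p
        have e : ∀ x, (u * (v + w)) x * eval x p =
            (u * v) x * eval x p + (u * w) x * eval x p := fun x => by
          simp only [BoundedContinuousFunction.mul_apply, BoundedContinuousFunction.add_apply]
          ring
        simp_rw [e]
        rw [integral_add (h.integrable_mul _ _) (h.integrable_mul _ _),
          integral_add (h'.integrable_mul _ _) (h'.integrable_mul _ _), hv u hu, hw u hu]
      | mul v w _ _ hv hw =>
        intro u hu p
        rw [← mul_assoc]
        exact hw _ (hv u hu) p
    intro g hg
    have := key g hg 1 (fun p => by
      simp only [BoundedContinuousFunction.coe_one, Pi.one_apply, one_mul]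
      rw [← h.integral_eq, ← h'.integral_eq]) 1
    simpa using this

end IsRepresenting

end Determinacy

/-- The example: for `f₁ = x₂ - x₁^k`, `f₂ = x₁` (with `k ≥ 1`), a linear functional `L`
on `ℝ[x₁, x₂]` satisfying `L(p²) ≥ 0`, `L(f₁ p²) ≥ 0`, `L(f₂ p²) ≥ 0` and the Stieltjes
conditions `∑ₙ L(f₁ⁿ)^{-1/(2n)} = ∑ₙ L(f₂ⁿ)^{-1/(2n)} = +∞` is a moment functional with
a unique representing measure, supported on
`K = {x ∈ ℝ² : x₁ ≥ 0, x₂ - x₁^k ≥ 0}`. -/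
theorem moment_problem_above_curve
    (k : ℕ) (hk : 1 ≤ k)
    (L : MvPolynomial (Fin 2) ℝ →ₗ[ℝ] ℝ)
    (hsq : ∀ p : MvPolynomial (Fin 2) ℝ, 0 ≤ L (p ^ 2))
    (hf1sq : ∀ p : MvPolynomial (Fin 2) ℝ, 0 ≤ L ((X 1 - X 0 ^ k) * p ^ 2))
    (hf2sq : ∀ p : MvPolynomial (Fin 2) ℝ, 0 ≤ L (X 0 * p ^ 2))
    (hser1 : ∑' n : ℕ,
      (ENNReal.ofReal (L ((X 1 - X 0 ^ k) ^ (n + 1)))) ^ (-(1 / (2 * ((n : ℝ) + 1)))) = ⊤)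
    (hser2 : ∑' n : ℕ,
      (ENNReal.ofReal (L (X 0 ^ (n + 1)))) ^ (-(1 / (2 * ((n : ℝ) + 1)))) = ⊤) :
    (∃ μ : Measure (Fin 2 → ℝ),
      μ {x | ¬ (0 ≤ x 0 ∧ 0 ≤ x 1 - x 0 ^ k)} = 0 ∧
      (∀ p : MvPolynomial (Fin 2) ℝ, Integrable (fun x => eval x p) μ) ∧
      (∀ p : MvPolynomial (Fin 2) ℝ, L p = ∫ x, eval x p ∂μ)) ∧
    (∀ μ₁ μ₂ : Measure (Fin 2 → ℝ),
      (∀ p : MvPolynomial (Fin 2) ℝ, Integrable (fun x => eval x p) μ₁) →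
      (∀ p : MvPolynomial (Fin 2) ℝ, L p = ∫ x, eval x p ∂μ₁) →
      (∀ p : MvPolynomial (Fin 2) ℝ, Integrable (fun x => eval x p) μ₂) →
      (∀ p : MvPolynomial (Fin 2) ℝ, L p = ∫ x, eval x p ∂μ₂) →
      μ₁ = μ₂) := by
  have h0 : IsStieltjes L (X 0) := ⟨hsq, hf2sq, hser2⟩
  have h1 : IsStieltjes L (X 1 - X 0 ^ k) := ⟨hsq, hf1sq, hser1⟩
  constructor
  · have hK : IsClosed {x : Fin 2 → ℝ | 0 ≤ x 0 ∧ 0 ≤ x 1 - x 0 ^ k} := by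
      simp only [Set.ofPred_and]
      exact (isClosed_le (by fun_prop) (by fun_prop)).inter
        (isClosed_le (by fun_prop) (by fun_prop))
    obtain ⟨μ, hμ, h⟩ := exists_representingMeasure hK fun p hp =>
      map_nonneg_of_eval_nonneg h0 h1 fun x hx hx' => hp x ⟨hx, hx'⟩
    exact ⟨μ, hμ, fun p => (h p).1, fun p => (h p).2⟩
  · intro μ₁ μ₂ hi₁ he₁ hi₂ he₂
    refine IsRepresenting.eq_of_isStieltjes (y := ![X 0, X 1 - X 0 ^ k])
      (Fin.forall_fin_two.2 ⟨h0, h1⟩) (fun x x' h => ?_) ⟨hi₁, he₁⟩ ⟨hi₂, he₂⟩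
    have e0 : x 0 = x' 0 := by simpa using h 0
    have e1 : x 1 = x' 1 := by simpa [e0] using h 1
    exact funext (Fin.forall_fin_two.2 ⟨e0, e1⟩)
end
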